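/- arXiv:2507.04328 — 8 statements merged into one kernel-verified Lean document; each statement's English description precedes it below -/
import Mathlib

section
/- Let 0 < β < α < 1. Then there exists a unique r⋆ ∈ (1, ∞) satisfying (α − β)·r⋆^β + β·r⋆^{β−1} − α = 0, and moreover r⋆ > (1 − β)/(α − β). -/
/-- The derivative of `r ↦ (α − β) r^β + β r^(β−1) − α`, with the power `r^(β−2)` factored out. -/
lemma hasDerivAt_rpow_combination (α β : ℝ) {r : ℝ} (hr : 0 < r) :
    HasDerivAt (fun r : ℝ => (α - β) * r ^ β + β * r ^ (β - 1) - α)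
      (β * r ^ (β - 2) * ((α - β) * r - (1 - β))) r := by
  have h := (((Real.hasDerivAt_rpow_const (p := β) (Or.inl hr.ne')).const_mul (α - β)).add
    ((Real.hasDerivAt_rpow_const (p := β - 1) (Or.inl hr.ne')).const_mul β)).sub_const α
  refine h.congr_deriv ?_
  have e : r ^ (β - 1) = r ^ (β - 2) * r := by
    rw [← Real.rpow_add_one hr.ne']
    congr 1
    ring
  rw [e, show β - 1 - 1 = β - 2 by ring]
  ring

/-- For `0 < β < α < 1`, the equation `(α − β) r^β + β r^(β−1) − α = 0` has a
unique solution `rs` in `(1, ∞)`, and moreover `rs > (1 − β)/(α − β)`. -/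
theorem stmt_1 (α β : ℝ) (hβ0 : 0 < β) (hβα : β < α) (hα1 : α < 1) :
    ∃ rs : ℝ, (1 < rs ∧ (α - β) * rs ^ β + β * rs ^ (β - 1) - α = 0) ∧
      (∀ r : ℝ, 1 < r → (α - β) * r ^ β + β * r ^ (β - 1) - α = 0 → r = rs) ∧
      (1 - β) / (α - β) < rs := by
  have hd : 0 < α - β := sub_pos.2 hβα
  set c := (1 - β) / (α - β) with hc
  have hc1 : 1 < c := by rw [hc, one_lt_div hd]; linarith
  set f : ℝ → ℝ := fun r => (α - β) * r ^ β + β * r ^ (β - 1) - α with hf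
  have hderiv (r : ℝ) (hr : 0 < r) := hasDerivAt_rpow_combination α β hr
  have hcont (s : Set ℝ) (hs : ∀ r ∈ s, 0 < r) : ContinuousOn f s := fun r hr =>
    (hderiv r (hs r hr)).continuousAt.continuousWithinAt
  have hanti : StrictAntiOn f (Set.Icc 1 c) := by
    refine strictAntiOn_of_deriv_neg (convex_Icc 1 c)
      (hcont _ fun r hr => one_pos.trans_le hr.1) fun r hr => ?_
    rw [interior_Icc] at hr
    have hr0 : 0 < r := one_pos.trans hr.1
    rw [(hderiv r hr0).deriv]
    have hrc := (lt_div_iff₀ hd).1 hr.2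
    exact mul_neg_of_pos_of_neg (by positivity) (by linarith)
  have hmono : StrictMonoOn f (Set.Ici c) := by
    refine strictMonoOn_of_deriv_pos (convex_Ici c)
      (hcont _ fun r hr => one_pos.trans (hc1.trans_le hr)) fun r hr => ?_
    rw [interior_Ici] at hr
    have hr0 : 0 < r := one_pos.trans (hc1.trans hr)
    rw [(hderiv r hr0).deriv]
    have hrc := (div_lt_iff₀ hd).1 hr
    exact mul_pos (by positivity) (by linarith)
  have hf1 : f 1 = 0 := by simp [hf]
  have hneg (r : ℝ) (h1 : 1 < r) (hrc : r ≤ c) : f r < 0 :=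
    hf1 ▸ hanti ⟨le_rfl, hc1.le⟩ ⟨h1.le, hrc⟩ h1
  obtain ⟨R, hR1, hfR⟩ : ∃ R, 1 < R ∧ 0 < f R := by
    have hq : 1 < α / (α - β) := by rw [one_lt_div hd]; linarith
    have hq0 : 0 < α / (α - β) := one_pos.trans hq
    refine ⟨(α / (α - β)) ^ β⁻¹, Real.one_lt_rpow hq (inv_pos.2 hβ0), ?_⟩
    simp only [hf]
    rw [Real.rpow_inv_rpow hq0.le hβ0.ne', mul_div_cancel₀ _ hd.ne', add_sub_cancel_left]
    positivity
  have hcR : c ≤ R := by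
    by_contra! h
    exact (hneg R hR1 h.le).not_gt hfR
  obtain ⟨rs, hrs, hrs0⟩ := intermediate_value_Icc hcR
    (hcont _ fun r hr => one_pos.trans (hc1.trans_le hr.1)) ⟨(hneg c hc1 le_rfl).le, hfR.le⟩
  have hroot (r : ℝ) (h1 : 1 < r) (hr : f r = 0) : c < r := by
    by_contra! h
    exact (hneg r h1 h).ne hr
  have hrs1 : 1 < rs := hc1.trans_le hrs.1
  exact ⟨rs, ⟨hrs1, hrs0⟩, fun r h1 hr =>
    hmono.injOn (hroot r h1 hr).le hrs.1 (hr.trans hrs0.symm), hroot rs hrs1 hrs0⟩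
end

section
/- Let 0 < β < α < 1 and let r⋆ be the unique solution in (1, ∞) of (α − β)r^β + β r^{β−1} − α = 0. Define Ψ(r) = (r^β − 1)/(r − 1)^α for r > 1. Then sup{Ψ(r) : r ∈ (1, ∞)} = Ψ(r⋆), and Ψ(r⋆) < 1. -/
lemma convexOn_affine_sub_rpow {α β : ℝ} (hα : 0 ≤ α) (hβ0 : 0 ≤ β) (hβ1 : β ≤ 1) :
    ConvexOn ℝ (Set.Ici 0) (fun s : ℝ => α - β + β * s - α * s ^ β) := by
  have hpow := ((Real.concaveOn_rpow hβ0 hβ1).smul hα).neg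
  have hid : ConvexOn ℝ (Set.Ici (0 : ℝ)) (fun s : ℝ => β * s) :=
    (convexOn_id (convex_Ici 0)).smul hβ0
  refine ((hid.add hpow).add_const (α - β)).congr fun s _ => ?_
  simp only [Pi.add_apply, Pi.neg_apply, smul_eq_mul]
  ring

lemma rpow_mul_affine_sub_rpow_inv {α β r : ℝ} (hr : 0 < r) :
    r ^ β * (α - β + β * r⁻¹ - α * r⁻¹ ^ β) = (α - β) * r ^ β + β * r ^ (β - 1) - α := by
  rw [Real.inv_rpow hr.le, Real.rpow_sub_one hr.ne']
  have := (Real.rpow_pos_of_pos hr β).ne'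
  field_simp

lemma hasDerivAt_rpow_sub_one_div {α β r : ℝ} (hr : 1 < r) :
    HasDerivAt (fun r : ℝ => (r ^ β - 1) / (r - 1) ^ α)
      (-((α - β) * r ^ β + β * r ^ (β - 1) - α) / ((r - 1) * (r - 1) ^ α)) r := by
  have hr0 : 0 < r := by linarith
  have hr1 : 0 < r - 1 := by linarith
  have hpos := Real.rpow_pos_of_pos hr1 α
  have hnum : HasDerivAt (fun r : ℝ => r ^ β - 1) (β * r ^ (β - 1)) r :=
    (Real.hasDerivAt_rpow_const (Or.inl hr0.ne')).sub_const 1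
  have hden : HasDerivAt (fun r : ℝ => (r - 1) ^ α) (1 * α * (r - 1) ^ (α - 1)) r :=
    ((hasDerivAt_id r).sub_const 1).rpow_const (Or.inl hr1.ne')
  refine (hnum.div hden hpos.ne').congr_deriv ?_
  rw [Real.rpow_sub_one hr0.ne', Real.rpow_sub_one hr1.ne']
  field_simp
  ring

lemma rpow_sub_one_div_lt_one {α β r : ℝ} (hβα : β < α) (hα0 : 0 ≤ α) (hα1 : α ≤ 1)
    (hr : 1 < r) : (r ^ β - 1) / (r - 1) ^ α < 1 := by
  have hr1 : 0 < r - 1 := by linarith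
  rw [div_lt_one (Real.rpow_pos_of_pos hr1 α)]
  have hlt : r ^ β < r ^ α := Real.rpow_lt_rpow_of_exponent_lt hr hβα
  have hadd := Real.rpow_add_le_add_rpow hr1.le zero_le_one hα0 hα1
  rw [sub_add_cancel, Real.one_rpow] at hadd
  linarith

/-- For `0 < β < α < 1` and `rs` the unique solution in `(1,∞)` of
`(α − β) r^β + β r^(β−1) − α = 0`, the function `Ψ(r) = (r^β − 1)/(r − 1)^α`
attains its supremum over `(1, ∞)` at `rs`, and `Ψ(rs) < 1`. -/
theorem stmt_2 (α β : ℝ) (hβ0 : 0 < β) (hβα : β < α) (hα1 : α < 1)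
    (rs : ℝ) (hrs : 1 < rs)
    (heq : (α - β) * rs ^ β + β * rs ^ (β - 1) - α = 0) :
    IsGreatest ((fun r : ℝ => (r ^ β - 1) / (r - 1) ^ α) '' Set.Ioi 1)
      ((rs ^ β - 1) / (rs - 1) ^ α) ∧
    (rs ^ β - 1) / (rs - 1) ^ α < 1 := by
  have hα0 : 0 < α := hβ0.trans hβα
  have hrs0 : 0 < rs := by linarith
  refine ⟨⟨⟨rs, hrs, rfl⟩, ?_⟩, rpow_sub_one_div_lt_one hβα hα0.le hα1.le hrs⟩
  have hconv := convexOn_affine_sub_rpow hα0.le hβ0.le (hβα.trans hα1).le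
  have hzero : α - β + β * rs⁻¹ - α * rs⁻¹ ^ β = 0 := by
    rw [← rpow_mul_affine_sub_rpow_inv hrs0] at heq
    exact (mul_eq_zero.mp heq).resolve_left (Real.rpow_pos_of_pos hrs0 β).ne'
  have hone : α - β + β * 1 - α * 1 ^ β = 0 := by rw [Real.one_rpow]; ring
  have hleft : ∀ r, 1 < r → r < rs → (α - β) * r ^ β + β * r ^ (β - 1) - α ≤ 0 := by
    intro r hr1 hr
    have hr0 : 0 < r := by linarith
    rw [← rpow_mul_affine_sub_rpow_inv hr0]
    refine mul_nonpos_of_nonneg_of_nonpos (Real.rpow_pos_of_pos hr0 β).le ?_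
    have h := hconv.le_max_of_mem_Icc (x := rs⁻¹) (y := 1) (z := r⁻¹)
      (inv_pos.mpr hrs0).le (zero_le_one' ℝ)
      ⟨inv_anti₀ hr0 hr.le, inv_le_one_of_one_le₀ hr1.le⟩
    simpa only [hzero, hone, max_self] using h
  have hright : ∀ r, rs < r → 0 ≤ (α - β) * r ^ β + β * r ^ (β - 1) - α := by
    intro r hr
    have hr0 : 0 < r := hrs0.trans hr
    rw [← rpow_mul_affine_sub_rpow_inv hr0]
    refine mul_nonneg (Real.rpow_pos_of_pos hr0 β).le ?_
    have hmem : rs⁻¹ ∈ openSegment ℝ r⁻¹ 1 := by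
      rw [openSegment_eq_Ioo (inv_lt_one_of_one_lt₀ (hrs.trans hr))]
      exact ⟨inv_strictAnti₀ hrs0 hr, inv_lt_one_of_one_lt₀ hrs⟩
    have h := hconv.le_left_of_right_le (x := r⁻¹) (y := 1)
      (inv_pos.mpr hr0).le (zero_le_one' ℝ) hmem (by simp only [hzero, hone, le_refl])
    simpa only [hzero] using h
  have hden : ∀ r : ℝ, 1 < r → 0 ≤ (r - 1) * (r - 1) ^ α := fun r hr =>
    mul_nonneg (by linarith) (Real.rpow_nonneg (by linarith) α)
  rintro _ ⟨r, hr, rfl⟩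
  rw [Set.mem_Ioi] at hr
  rcases le_total r rs with hle | hle
  · refine monotoneOn_of_deriv_nonneg (convex_Ioc 1 rs)
      (fun x hx => (hasDerivAt_rpow_sub_one_div hx.1).continuousAt.continuousWithinAt)
      (fun x hx => ?_) (fun x hx => ?_) ⟨hr, hle⟩ ⟨hrs, le_rfl⟩ hle
    · exact (hasDerivAt_rpow_sub_one_div
        (interior_subset hx).1).differentiableAt.differentiableWithinAt
    · rw [interior_Ioc] at hx
      rw [(hasDerivAt_rpow_sub_one_div hx.1).deriv]
      exact div_nonneg (neg_nonneg.mpr (hleft x hx.1 hx.2)) (hden x hx.1)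
  · refine antitoneOn_of_deriv_nonpos (convex_Ici rs)
      (fun x hx => (hasDerivAt_rpow_sub_one_div
        (hrs.trans_le hx)).continuousAt.continuousWithinAt)
      (fun x hx => ?_) (fun x hx => ?_) Set.self_mem_Ici hle hle
    · exact (hasDerivAt_rpow_sub_one_div
        (hrs.trans_le (interior_subset hx))).differentiableAt.differentiableWithinAt
    · rw [interior_Ici] at hx
      have hx1 : 1 < x := hrs.trans hx
      rw [(hasDerivAt_rpow_sub_one_div hx1).deriv]
      exact div_nonpos_of_nonpos_of_nonneg (neg_nonpos.mpr (hright x hx)) (hden x hx1)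
end

section
/- Let α ∈ (0,1), let x₀ ∈ Ω̄, and define ψ(x) = |x − x₀|^α. Then for every x ∈ Ω with x ≠ x₀ one has |x − x₀| < diam(Ω), and, setting R = diam(Ω)/|x − x₀| > 1, L[ψ](x) ≤ −1 + (R^α − 1)/(R − 1)^α < 0. -/
open Set Metric

/-- The fractional sup-operator `L⁺[u](x)`. -/
noncomputable def Lplus {n : ℕ} (Ω : Set (EuclideanSpace ℝ (Fin n))) (α : ℝ)
    (u : EuclideanSpace ℝ (Fin n) → ℝ) (x : EuclideanSpace ℝ (Fin n)) : ℝ :=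
  sSup ((fun y => (u y - u x) / ‖y - x‖ ^ α) '' (closure Ω \ {x}))

/-- The fractional inf-operator `L⁻[u](x)`. -/
noncomputable def Lminus {n : ℕ} (Ω : Set (EuclideanSpace ℝ (Fin n))) (α : ℝ)
    (u : EuclideanSpace ℝ (Fin n) → ℝ) (x : EuclideanSpace ℝ (Fin n)) : ℝ :=
  sInf ((fun y => (u y - u x) / ‖y - x‖ ^ α) '' (closure Ω \ {x}))

/-- The fractional infinity Laplacian `L[u](x) = L⁺[u](x) + L⁻[u](x)`. -/
noncomputable def Lop {n : ℕ} (Ω : Set (EuclideanSpace ℝ (Fin n))) (α : ℝ)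
    (u : EuclideanSpace ℝ (Fin n) → ℝ) (x : EuclideanSpace ℝ (Fin n)) : ℝ :=
  Lplus Ω α u x + Lminus Ω α u x

/-- A concave power is monotone under spreading: if `1 ≤ t`, `1 ≤ k` and `1 < m` with
`t + k = m + 1`, then `m ^ α + 1 ≤ t ^ α + k ^ α`. -/
lemma rpow_add_one_le_rpow_add_rpow {α t k m : ℝ} (hα0 : 0 ≤ α) (hα1 : α ≤ 1)
    (ht : 1 ≤ t) (hk : 1 ≤ k) (hm : 1 < m) (h : t + k = m + 1) :
    m ^ α + 1 ≤ t ^ α + k ^ α := by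
  have hc := (Real.concaveOn_rpow hα0 hα1).2
  have hm1 : 0 < m - 1 := by linarith
  have h1 : (1 : ℝ) ∈ Set.Ici (0 : ℝ) := Set.mem_Ici.2 zero_le_one
  have h2 : m ∈ Set.Ici (0 : ℝ) := Set.mem_Ici.2 (by linarith)
  have ha : 0 ≤ (t - 1) / (m - 1) := div_nonneg (by linarith) hm1.le
  have hb : 0 ≤ (k - 1) / (m - 1) := div_nonneg (by linarith) hm1.le
  have hab : (t - 1) / (m - 1) + (k - 1) / (m - 1) = 1 := by
    rw [← add_div, div_eq_one_iff_eq hm1.ne']; linarith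
  have e1 := hc h2 h1 ha hb hab
  have e2 := hc h1 h2 ha hb hab
  simp only [smul_eq_mul, Real.one_rpow] at e1 e2
  have ek : (t - 1) / (m - 1) * 1 + (k - 1) / (m - 1) * m = k := by
    field_simp
    rw [show t = m + 1 - k by linarith]; ring
  have et : (t - 1) / (m - 1) * m + (k - 1) / (m - 1) * 1 = t := by
    field_simp
    rw [show k = m + 1 - t by linarith]; ring
  rw [et] at e1
  rw [ek] at e2
  calc m ^ α + 1 = ((t - 1) / (m - 1) + (k - 1) / (m - 1)) * (m ^ α + 1) := by
        rw [hab, one_mul]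
    _ ≤ t ^ α + k ^ α := by linarith

/-- The quotient `(t ^ α - 1) / (t - 1) ^ α` is monotone on `(1, ∞)`. -/
lemma rpow_sub_one_div_sub_one_rpow_le {α s t : ℝ} (hα0 : 0 ≤ α) (hα1 : α ≤ 1)
    (hs : 1 < s) (hst : s ≤ t) :
    (s ^ α - 1) / (s - 1) ^ α ≤ (t ^ α - 1) / (t - 1) ^ α := by
  have hs1 : 0 < s - 1 := by linarith
  have ht1 : 0 < t - 1 := by linarith
  obtain ⟨k, hk⟩ : ∃ k, k = (t - 1) / (s - 1) := ⟨_, rfl⟩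
  have hk1 : 1 ≤ k := by rw [hk, one_le_div hs1]; linarith
  have hkt : t - 1 = k * (s - 1) := by rw [hk]; field_simp
  have key := rpow_add_one_le_rpow_add_rpow (t := t) (k := k) (m := k * s) hα0 hα1
    (by linarith) hk1 (by nlinarith) (by linarith)
  rw [Real.mul_rpow (by linarith) (by linarith)] at key
  have hp : 0 < (s - 1) ^ α := Real.rpow_pos_of_pos hs1 α
  have hkp : 0 < k ^ α := Real.rpow_pos_of_pos (by linarith) α
  rw [hkt, Real.mul_rpow (by linarith) hs1.le, div_le_div_iff₀ hp (by positivity)]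
  nlinarith

lemma rpow_sub_one_lt_sub_one_rpow {α R : ℝ} (hα0 : 0 < α) (hα1 : α < 1) (hR : 1 < R) :
    R ^ α - 1 < (R - 1) ^ α := by
  have hR1 : 0 < R - 1 := by linarith
  have h1 : R ^ (α - 1) < (R - 1) ^ (α - 1) :=
    Real.rpow_lt_rpow_of_neg hR1 (by linarith) (by linarith)
  have h2 : R ^ (α - 1) < 1 := Real.rpow_lt_one_of_one_lt_of_neg hR (by linarith)
  have e1 : R ^ α = R ^ (α - 1) * R := by
    rw [Real.rpow_sub_one (by linarith)]; field_simp
  have e2 : (R - 1) ^ α = (R - 1) ^ (α - 1) * (R - 1) := by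
    rw [Real.rpow_sub_one hR1.ne']; field_simp
  rw [e1, e2]
  nlinarith

/-- A point of an open bounded set in a normed space has distance less than the diameter from
any other point of the closure. -/
lemma norm_sub_lt_diam {E : Type*} [NormedAddCommGroup E] [NormedSpace ℝ E] {Ω : Set E}
    (hΩo : IsOpen Ω) (hΩb : Bornology.IsBounded Ω) {x x₀ : E} (hx : x ∈ Ω)
    (hx₀ : x₀ ∈ closure Ω) (hne : x ≠ x₀) : ‖x - x₀‖ < Metric.diam Ω := by
  have hc : Filter.Tendsto (fun ε : ℝ => x + ε • (x - x₀)) (nhdsWithin 0 (Set.Ioi 0))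
      (nhds x) := by
    have : Continuous (fun ε : ℝ => x + ε • (x - x₀)) := by fun_prop
    simpa using (this.tendsto 0).mono_left nhdsWithin_le_nhds
  obtain ⟨ε, hεΩ, hε⟩ :=
    ((hc.eventually (hΩo.mem_nhds hx)).and self_mem_nhdsWithin).exists
  have hε : 0 < ε := hε
  have hr : 0 < ‖x - x₀‖ := norm_pos_iff.2 (sub_ne_zero.2 hne)
  have hd := Metric.dist_le_diam_of_mem hΩb.closure (subset_closure hεΩ) hx₀
  rw [Metric.diam_closure, dist_eq_norm,
    show x + ε • (x - x₀) - x₀ = (1 + ε) • (x - x₀) by rw [add_smul, one_smul]; abel,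
    norm_smul, Real.norm_of_nonneg (by linarith)] at hd
  nlinarith

/-- The upper difference quotient of `‖· - x₀‖ ^ α` is controlled by the radial one. -/
lemma rpow_norm_sub_div_le {E : Type*} [NormedAddCommGroup E] {α D : ℝ}
    (hα0 : 0 ≤ α) (hα1 : α ≤ 1) {x x₀ y : E} (hne : x ≠ x₀) (hxD : ‖x - x₀‖ < D)
    (hyD : ‖y - x₀‖ ≤ D) :
    (‖y - x₀‖ ^ α - ‖x - x₀‖ ^ α) / ‖y - x‖ ^ α ≤
      ((D / ‖x - x₀‖) ^ α - 1) / (D / ‖x - x₀‖ - 1) ^ α := by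
  have hr : 0 < ‖x - x₀‖ := norm_pos_iff.2 (sub_ne_zero.2 hne)
  have hR : 1 < D / ‖x - x₀‖ := (one_lt_div hr).2 hxD
  rcases le_or_gt ‖y - x₀‖ ‖x - x₀‖ with h | h
  · have h1 := Real.rpow_le_rpow (norm_nonneg _) h hα0
    have h2 := Real.one_le_rpow hR.le hα0
    exact (div_nonpos_of_nonpos_of_nonneg (by linarith) (by positivity)).trans
      (div_nonneg (by linarith) (Real.rpow_nonneg (by linarith) _))
  · have htri : ‖y - x₀‖ - ‖x - x₀‖ ≤ ‖y - x‖ := by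
      simpa using norm_sub_norm_le (y - x₀) (x - x₀)
    have hd : 0 < ‖y - x₀‖ - ‖x - x₀‖ := by linarith
    have h1 := Real.rpow_le_rpow hr.le h.le hα0
    have hs : 1 < ‖y - x₀‖ / ‖x - x₀‖ := (one_lt_div hr).2 h
    calc (‖y - x₀‖ ^ α - ‖x - x₀‖ ^ α) / ‖y - x‖ ^ α
        ≤ (‖y - x₀‖ ^ α - ‖x - x₀‖ ^ α) / (‖y - x₀‖ - ‖x - x₀‖) ^ α :=
          div_le_div_of_nonneg_left (by linarith) (Real.rpow_pos_of_pos hd α)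
            (Real.rpow_le_rpow hd.le htri hα0)
      _ = ((‖y - x₀‖ / ‖x - x₀‖) ^ α - 1) / (‖y - x₀‖ / ‖x - x₀‖ - 1) ^ α := by
          have hp := Real.rpow_pos_of_pos hr α
          rw [div_sub_one hr.ne', Real.div_rpow hd.le hr.le,
            Real.div_rpow (norm_nonneg _) hr.le, div_sub_one hp.ne',
            div_div_div_cancel_right₀ hp.ne']
      _ ≤ _ := rpow_sub_one_div_sub_one_rpow_le hα0 hα1 hs (by gcongr)

/-- The function `‖· - x₀‖ ^ α` has `α`-Hölder constant at most one. -/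
lemma neg_one_le_rpow_norm_sub_div {E : Type*} [NormedAddCommGroup E] {α : ℝ}
    (hα0 : 0 ≤ α) (hα1 : α ≤ 1) (x x₀ y : E) :
    -1 ≤ (‖y - x₀‖ ^ α - ‖x - x₀‖ ^ α) / ‖y - x‖ ^ α := by
  have htri : ‖x - x₀‖ ≤ ‖y - x₀‖ + ‖y - x‖ := by
    have := norm_sub_le_norm_sub_add_norm_sub x y x₀
    rw [norm_sub_rev x y] at this
    linarith
  have h := (Real.rpow_le_rpow (norm_nonneg _) htri hα0).trans
    (Real.rpow_add_le_add_rpow (norm_nonneg _) (norm_nonneg _) hα0 hα1)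
  rcases (Real.rpow_nonneg (norm_nonneg (y - x)) α).eq_or_lt with h0 | h0
  · simp [← h0]
  · rw [le_div_iff₀ h0]; linarith

/-- For `α ∈ (0,1)`, `x₀ ∈ Ω̄` and `ψ(x) = ‖x − x₀‖^α`, for every `x ∈ Ω` with
`x ≠ x₀` one has `‖x − x₀‖ < diam Ω`, and with `R = diam Ω / ‖x − x₀‖ > 1`,
`L[ψ](x) ≤ −1 + (R^α − 1)/(R − 1)^α < 0`. -/
theorem stmt_4 (n : ℕ) (hn : 1 ≤ n) (Ω : Set (EuclideanSpace ℝ (Fin n)))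
    (hΩo : IsOpen Ω) (hΩne : Ω.Nonempty) (hΩb : Bornology.IsBounded Ω)
    (α : ℝ) (hα0 : 0 < α) (hα1 : α < 1)
    (x₀ : EuclideanSpace ℝ (Fin n)) (hx₀ : x₀ ∈ closure Ω)
    (x : EuclideanSpace ℝ (Fin n)) (hx : x ∈ Ω) (hxx₀ : x ≠ x₀) :
    ‖x - x₀‖ < Metric.diam Ω ∧
    1 < Metric.diam Ω / ‖x - x₀‖ ∧
    Lop Ω α (fun z => ‖z - x₀‖ ^ α) x ≤
      -1 + ((Metric.diam Ω / ‖x - x₀‖) ^ α - 1) /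
        (Metric.diam Ω / ‖x - x₀‖ - 1) ^ α ∧
    -1 + ((Metric.diam Ω / ‖x - x₀‖) ^ α - 1) /
        (Metric.diam Ω / ‖x - x₀‖ - 1) ^ α < 0 := by
  have hlt := norm_sub_lt_diam hΩo hΩb hx hx₀ hxx₀
  have hr : 0 < ‖x - x₀‖ := norm_pos_iff.2 (sub_ne_zero.2 hxx₀)
  have hR : 1 < Metric.diam Ω / ‖x - x₀‖ := (one_lt_div hr).2 hlt
  have hx₀mem : x₀ ∈ closure Ω \ {x} := ⟨hx₀, fun h => hxx₀ h.symm⟩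
  refine ⟨hlt, hR, ?_, ?_⟩
  · have hplus : Lplus Ω α (fun z => ‖z - x₀‖ ^ α) x ≤
        ((Metric.diam Ω / ‖x - x₀‖) ^ α - 1) / (Metric.diam Ω / ‖x - x₀‖ - 1) ^ α := by
      refine csSup_le (Set.Nonempty.image _ ⟨x₀, hx₀mem⟩) ?_
      rintro _ ⟨y, hy, rfl⟩
      refine rpow_norm_sub_div_le hα0.le hα1.le hxx₀ hlt ?_
      rw [← dist_eq_norm, ← Metric.diam_closure]
      exact Metric.dist_le_diam_of_mem hΩb.closure hy.1 hx₀
    have hminus : Lminus Ω α (fun z => ‖z - x₀‖ ^ α) x ≤ -1 := by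
      refine csInf_le ⟨-1, ?_⟩ ⟨x₀, hx₀mem, ?_⟩
      · rintro _ ⟨y, -, rfl⟩
        exact neg_one_le_rpow_norm_sub_div hα0.le hα1.le x x₀ y
      · have hp := Real.rpow_pos_of_pos hr α
        simp only [sub_self, norm_zero, Real.zero_rpow hα0.ne', zero_sub, norm_sub_rev x₀ x]
        rw [neg_div, div_self hp.ne']
    unfold Lop
    linarith
  · have h := (div_lt_one (Real.rpow_pos_of_pos (sub_pos.2 hR) α)).2
      (rpow_sub_one_lt_sub_one_rpow hα0 hα1 hR)
    linarith
end

section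
/- Let α ∈ (0,1] and let φ : ℝⁿ → ℝ be continuously differentiable on Ω and continuous on Ω̄. Then the functions x ↦ L⁺[φ](x) and x ↦ L⁻[φ](x) are continuous on Ω; consequently x ↦ L[φ](x) is continuous on Ω. -/
open Set Metric

/-- Two sets of reals that are each contained in the closed `ε`-thickening of the other have
suprema at distance at most `ε`; when both are unbounded above or empty, the junk values agree. -/
theorem abs_sSup_sub_sSup_le {S T : Set ℝ} {ε : ℝ} (hε : 0 ≤ ε)
    (hST : ∀ s ∈ S, ∃ t ∈ T, |s - t| ≤ ε) (hTS : ∀ t ∈ T, ∃ s ∈ S, |t - s| ≤ ε) :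
    |sSup S - sSup T| ≤ ε := by
  have bdd : ∀ A B : Set ℝ, (∀ s ∈ A, ∃ t ∈ B, |s - t| ≤ ε) → BddAbove B → BddAbove A := by
    rintro A B h ⟨M, hM⟩
    refine ⟨M + ε, fun s hs => ?_⟩
    obtain ⟨t, ht, hst⟩ := h s hs
    linarith [hM ht, (abs_le.mp hst).2]
  have le : ∀ A B : Set ℝ, A.Nonempty → BddAbove B → (∀ s ∈ A, ∃ t ∈ B, |s - t| ≤ ε) →
      sSup A ≤ sSup B + ε := by
    intro A B hA hB h
    refine csSup_le hA fun s hs => ?_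
    obtain ⟨t, ht, hst⟩ := h s hs
    linarith [le_csSup hB ht, (abs_le.mp hst).2]
  rcases S.eq_empty_or_nonempty with rfl | hS
  · have hT : T = ∅ := eq_empty_of_forall_notMem fun t ht => by simpa using hTS t ht
    simpa [hT] using hε
  obtain ⟨s, hs⟩ := hS
  obtain ⟨t, ht, -⟩ := hST s hs
  by_cases hb : BddAbove S
  · have hbT := bdd T S hTS hb
    rw [abs_le]
    constructor <;> linarith [le S T ⟨s, hs⟩ hbT hST, le T S ⟨t, ht⟩ hb hTS]
  · have hbT : ¬ BddAbove T := fun h => hb (bdd S T hST h)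
    simpa [Real.sSup_of_not_bddAbove hb, Real.sSup_of_not_bddAbove hbT] using hε

/-- Near a point of strict differentiability, difference quotients with a common small
displacement are uniformly close to each other. -/
theorem HasStrictFDerivAt.exists_abs_quotient_sub_le {E : Type*} [NormedAddCommGroup E]
    [NormedSpace ℝ E] {f : E → ℝ} {f' : E →L[ℝ] ℝ} {x₀ : E} (hf : HasStrictFDerivAt f f' x₀)
    {α : ℝ} (hα : α ≤ 1) {ε : ℝ} (hε : 0 < ε) :
    ∃ r > 0, ∀ a ∈ ball x₀ r, ∀ b ∈ ball x₀ r, ∀ v : E, v ≠ 0 → ‖v‖ < r →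
      |(f (a + v) - f a) / ‖v‖ ^ α - (f (b + v) - f b) / ‖v‖ ^ α| ≤ ε := by
  have h := hf.isLittleO.def (half_pos hε)
  rw [nhds_prod_eq] at h
  obtain ⟨r, hr, hball⟩ := (Metric.nhds_basis_ball.prod_self).eventually_iff.mp h
  have key : ∀ a ∈ ball x₀ (min (r / 2) 1), ∀ v : E, ‖v‖ < min (r / 2) 1 →
      |f (a + v) - f a - f' v| ≤ ε / 2 * ‖v‖ := by
    intro a ha v hv
    rw [mem_ball, dist_eq_norm] at ha
    have hmin := min_le_left (r / 2) 1
    have hav : a + v ∈ ball x₀ r := by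
      rw [mem_ball, dist_eq_norm, add_sub_right_comm]
      linarith [norm_add_le (a - x₀) v]
    have haa : a ∈ ball x₀ r := by
      rw [mem_ball, dist_eq_norm]
      linarith
    simpa using hball (show (a + v, a) ∈ ball x₀ r ×ˢ ball x₀ r from ⟨hav, haa⟩)
  refine ⟨min (r / 2) 1, by positivity, fun a ha b hb v hv0 hv => ?_⟩
  have hpos : 0 < ‖v‖ := norm_pos_iff.mpr hv0
  have hle : ‖v‖ ≤ ‖v‖ ^ α := by
    simpa using Real.rpow_le_rpow_of_exponent_ge hpos
      (hv.le.trans (min_le_right _ _)) hα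
  have hA := abs_le.mp (key a ha v hv)
  have hB := abs_le.mp (key b hb v hv)
  have hεv : ε * ‖v‖ ≤ ε * ‖v‖ ^ α := by gcongr
  rw [← sub_div, abs_div, _root_.abs_of_pos (Real.rpow_pos_of_pos hpos α),
    div_le_iff₀ (Real.rpow_pos_of_pos hpos α)]
  refine le_trans ?_ hεv
  rw [abs_le]
  constructor <;> linarith [hA.1, hA.2, hB.1, hB.2]

/-- On a compact set, difference quotients with displacement bounded below are uniformly
continuous in the base point. -/
theorem IsCompact.exists_abs_quotient_sub_le {E : Type*} [NormedAddCommGroup E]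
    {K : Set E} (hK : IsCompact K) {f : E → ℝ} (hf : ContinuousOn f K) (α : ℝ)
    {ρ : ℝ} (hρ : 0 < ρ) {ε : ℝ} (hε : 0 < ε) :
    ∃ δ > 0, ∀ a ∈ K, ∀ b ∈ K, dist a b < δ → ∀ y ∈ K, ρ ≤ ‖y - a‖ → ρ ≤ ‖y - b‖ →
      |(f y - f a) / ‖y - a‖ ^ α - (f y - f b) / ‖y - b‖ ^ α| ≤ ε := by
  set C : Set (E × E) := (K ×ˢ K) ∩ {p | ρ ≤ ‖p.2 - p.1‖}
  have hCc : IsCompact C :=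
    (hK.prod hK).inter_right (isClosed_le continuous_const (by fun_prop))
  have hpos : ∀ p ∈ C, 0 < ‖p.2 - p.1‖ := fun p hp => hρ.trans_le hp.2
  have hcont : ContinuousOn (fun p : E × E => (f p.2 - f p.1) / ‖p.2 - p.1‖ ^ α) C := by
    refine ContinuousOn.div ?_ ?_ fun p hp => (Real.rpow_pos_of_pos (hpos p hp) α).ne'
    · exact (hf.comp continuousOn_snd fun p hp => hp.1.2).sub
        (hf.comp continuousOn_fst fun p hp => hp.1.1)
    · exact ContinuousOn.rpow_const (by fun_prop) fun p hp => Or.inl (hpos p hp).ne'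
  obtain ⟨δ, hδ, h⟩ :=
    Metric.uniformContinuousOn_iff.mp (hCc.uniformContinuousOn_of_continuous hcont) ε hε
  refine ⟨δ, hδ, fun a ha b hb hab y hy hya hyb => ?_⟩
  have := h (a, y) ⟨⟨ha, hy⟩, hya⟩
    (b, y) ⟨⟨hb, hy⟩, hyb⟩ (by simpa [Prod.dist_eq] using hab)
  exact (Real.dist_eq _ _ ▸ this).le

theorem continuousOn_Lplus {n : ℕ} {Ω : Set (EuclideanSpace ℝ (Fin n))}
    (hΩo : IsOpen Ω) (hΩb : Bornology.IsBounded Ω) {α : ℝ} (hα : α ≤ 1)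
    {φ : EuclideanSpace ℝ (Fin n) → ℝ}
    (hφ1 : ContDiffOn ℝ 1 φ Ω) (hφc : ContinuousOn φ (closure Ω)) :
    ContinuousOn (Lplus Ω α φ) Ω := by
  intro x₀ hx₀
  refine ContinuousAt.continuousWithinAt (Metric.continuousAt_iff'.mpr fun ε hε => ?_)
  have hstrict := (hφ1.contDiffAt (hΩo.mem_nhds hx₀)).hasStrictFDerivAt one_ne_zero
  obtain ⟨r₁, hr₁, hnear⟩ := hstrict.exists_abs_quotient_sub_le hα (half_pos hε)
  obtain ⟨r₂, hr₂, hball⟩ := Metric.isOpen_iff.mp hΩo x₀ hx₀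
  set r := min r₁ (r₂ / 2)
  have hrpos : 0 < r := by positivity
  have hrr₁ : r ≤ r₁ := min_le_left _ _
  have hrr₂ : r ≤ r₂ / 2 := min_le_right _ _
  obtain ⟨δ, hδ, hfar⟩ := hΩb.isCompact_closure.exists_abs_quotient_sub_le hφc α
    (half_pos hrpos) (half_pos hε)
  have key : ∀ a ∈ ball x₀ (r / 2), ∀ b ∈ ball x₀ (r / 2), dist a b < min δ (r / 2) →
      ∀ s ∈ (fun y => (φ y - φ a) / ‖y - a‖ ^ α) '' (closure Ω \ {a}),
      ∃ t ∈ (fun y => (φ y - φ b) / ‖y - b‖ ^ α) '' (closure Ω \ {b}), |s - t| ≤ ε / 2 := by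
    rintro a ha b hb hab _ ⟨y, ⟨hy, hya⟩, rfl⟩
    have hsub : ball x₀ (r / 2) ⊆ ball x₀ r₂ := ball_subset_ball (by linarith)
    by_cases hyr : ‖y - a‖ < r
    · have hv : y - a ≠ 0 := sub_ne_zero.mpr hya
      refine ⟨_, ⟨b + (y - a), ⟨subset_closure (hball ?_), by simpa using hv⟩, rfl⟩, ?_⟩
      · rw [mem_ball, dist_eq_norm] at hb ⊢
        rw [add_sub_right_comm]
        linarith [norm_add_le (b - x₀) (y - a)]
      · have hsub₁ : ball x₀ (r / 2) ⊆ ball x₀ r₁ := ball_subset_ball (by linarith)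
        simpa using hnear a (hsub₁ ha) b (hsub₁ hb) (y - a) hv (hyr.trans_le hrr₁)
    · have hyb : r / 2 ≤ ‖y - b‖ := by
        have h₁ := dist_triangle y b a
        have h₂ := hab.trans_le (min_le_right _ _)
        rw [dist_comm b a, dist_eq_norm y a, dist_eq_norm y b] at h₁
        linarith
      refine ⟨_, ⟨y, ⟨hy, fun h => ?_⟩, rfl⟩, ?_⟩
      · rw [mem_singleton_iff.mp h, sub_self, norm_zero] at hyb
        linarith
      · exact hfar a (subset_closure (hball (hsub ha))) b (subset_closure (hball (hsub hb)))
          (hab.trans_le (min_le_left _ _)) y hy (by linarith) hyb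
  filter_upwards [ball_mem_nhds x₀ (show 0 < min δ (r / 2) by positivity)] with x hx
  have hxr : x ∈ ball x₀ (r / 2) := ball_subset_ball (min_le_right _ _) hx
  have hx₀r : x₀ ∈ ball x₀ (r / 2) := mem_ball_self (half_pos hrpos)
  rw [Real.dist_eq]
  exact (abs_sSup_sub_sSup_le (half_pos hε).le (key x hxr x₀ hx₀r hx)
    (key x₀ hx₀r x hxr (mem_ball'.mp hx))).trans_lt (half_lt_self hε)

theorem Lminus_eq_neg_Lplus_neg {n : ℕ} (Ω : Set (EuclideanSpace ℝ (Fin n))) (α : ℝ)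
    (u : EuclideanSpace ℝ (Fin n) → ℝ) : Lminus Ω α u = -Lplus Ω α (-u) := by
  funext x
  rw [Pi.neg_apply, Lminus, Lplus, Real.sInf_def, ← Set.image_neg_eq_neg, Set.image_image]
  congr 3
  funext y
  simp only [Pi.neg_apply]
  ring

/-- If `φ` is `C¹` on `Ω` and continuous on `Ω̄`, then `L⁺[φ]`, `L⁻[φ]` and
hence `L[φ]` are continuous on `Ω`. -/
theorem stmt_7 (n : ℕ) (hn : 1 ≤ n) (Ω : Set (EuclideanSpace ℝ (Fin n)))
    (hΩo : IsOpen Ω) (hΩne : Ω.Nonempty) (hΩb : Bornology.IsBounded Ω)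
    (α : ℝ) (hα0 : 0 < α) (hα1 : α ≤ 1)
    (φ : EuclideanSpace ℝ (Fin n) → ℝ)
    (hφ1 : ContDiffOn ℝ 1 φ Ω) (hφc : ContinuousOn φ (closure Ω)) :
    ContinuousOn (Lplus Ω α φ) Ω ∧ ContinuousOn (Lminus Ω α φ) Ω ∧
    ContinuousOn (Lop Ω α φ) Ω := by
  have hp := continuousOn_Lplus hΩo hΩb hα1 hφ1 hφc
  have hm : ContinuousOn (Lminus Ω α φ) Ω := by
    rw [Lminus_eq_neg_Lplus_neg]
    exact (continuousOn_Lplus hΩo hΩb hα1 hφ1.neg hφc.neg).neg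
  exact ⟨hp, hm, hp.add hm⟩
end

section
/- Let α ∈ (0,1], let φ : ℝⁿ → ℝ be continuously differentiable on Ω and continuous on Ω̄, let x₀ ∈ Ω̄ and δ ∈ ℝ, and define φ_δ(x) = φ(x) + δ|x − x₀|². Then for every x ∈ Ω̄, |L⁺[φ_δ](x) − L⁺[φ](x)| ≤ 2|δ|·diam(Ω)^{2−α}, |L⁻[φ_δ](x) − L⁻[φ](x)| ≤ 2|δ|·diam(Ω)^{2−α}, and hence |L[φ_δ](x) − L[φ](x)| ≤ 4|δ|·diam(Ω)^{2−α}. -/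
open Set Metric

/-- The supremum over a set is monotone up to a uniform error. -/
lemma sSup_image_le_sSup_image_add {β : Type*} {s : Set β} {f g : β → ℝ} {C : ℝ}
    (hs : s.Nonempty) (hg : BddAbove (g '' s)) (h : ∀ y ∈ s, f y ≤ g y + C) :
    sSup (f '' s) ≤ sSup (g '' s) + C := by
  refine csSup_le (hs.image f) ?_
  rintro _ ⟨y, hy, rfl⟩
  linarith [h y hy, le_csSup hg (mem_image_of_mem g hy)]

lemma BddAbove.image_of_le_add {β : Type*} {s : Set β} {f g : β → ℝ} {C : ℝ}
    (hg : BddAbove (g '' s)) (h : ∀ y ∈ s, f y ≤ g y + C) : BddAbove (f '' s) := by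
  obtain ⟨M, hM⟩ := hg
  refine ⟨M + C, ?_⟩
  rintro _ ⟨y, hy, rfl⟩
  linarith [h y hy, hM (mem_image_of_mem g hy)]

/-- Suprema of uniformly close real functions are close. No boundedness is needed: the two images
are bounded above simultaneously, and otherwise both suprema are `0`. -/
lemma abs_sSup_image_sub_sSup_image_le {β : Type*} {s : Set β} {f g : β → ℝ} {C : ℝ}
    (hC : 0 ≤ C) (h : ∀ y ∈ s, |f y - g y| ≤ C) :
    |sSup (f '' s) - sSup (g '' s)| ≤ C := by
  rcases s.eq_empty_or_nonempty with rfl | hs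
  · simpa using hC
  have hfg : ∀ y ∈ s, f y ≤ g y + C := fun y hy => by linarith [(abs_le.1 (h y hy)).2]
  have hgf : ∀ y ∈ s, g y ≤ f y + C := fun y hy => by linarith [(abs_le.1 (h y hy)).1]
  by_cases hg : BddAbove (g '' s)
  · have hf := hg.image_of_le_add hfg
    rw [abs_le]
    constructor
    · linarith [sSup_image_le_sSup_image_add hs hf hgf]
    · linarith [sSup_image_le_sSup_image_add hs hg hfg]
  · have hf : ¬ BddAbove (f '' s) := fun hf => hg (hf.image_of_le_add hgf)
    rw [Real.sSup_of_not_bddAbove hg, Real.sSup_of_not_bddAbove hf]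
    simpa using hC

/-- Infima of uniformly close real functions are close. -/
lemma abs_sInf_image_sub_sInf_image_le {β : Type*} {s : Set β} {f g : β → ℝ} {C : ℝ}
    (hC : 0 ≤ C) (h : ∀ y ∈ s, |f y - g y| ≤ C) :
    |sInf (f '' s) - sInf (g '' s)| ≤ C := by
  have key := abs_sSup_image_sub_sSup_image_le (f := fun y => -f y) (g := fun y => -g y) hC
    (fun y hy => by rw [neg_sub_neg, abs_sub_comm]; exact h y hy)
  have neg_image : ∀ k : β → ℝ, -(k '' s) = (fun y => -k y) '' s := fun k => by
    rw [← Set.image_neg_eq_neg, Set.image_image]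
  rw [Real.sInf_def, Real.sInf_def, neg_image, neg_image, neg_sub_neg, abs_sub_comm]
  exact key

/-- The `α`-Hölder quotient of `‖· - x₀‖ ^ 2` between points at mutual distance at most `d`. -/
lemma abs_sq_norm_sub_div_rpow_le {E : Type*} [NormedAddCommGroup E] {x y x₀ : E} {α d : ℝ}
    (hα : α ≤ 1) (hyx : y ≠ x) (hd : ‖y - x‖ ≤ d) (hy : ‖y - x₀‖ ≤ d) (hx : ‖x - x₀‖ ≤ d) :
    |(‖y - x₀‖ ^ 2 - ‖x - x₀‖ ^ 2) / ‖y - x‖ ^ α| ≤ 2 * d ^ (2 - α) := by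
  have hr : 0 < ‖y - x‖ := norm_pos_iff.2 (sub_ne_zero.2 hyx)
  have hd0 : 0 < d := hr.trans_le hd
  have hdiff : |‖y - x₀‖ - ‖x - x₀‖| ≤ ‖y - x‖ := by
    simpa using abs_norm_sub_norm_le (y - x₀) (x - x₀)
  have hpow : ‖y - x‖ = ‖y - x‖ ^ (1 - α) * ‖y - x‖ ^ α := by
    rw [← Real.rpow_add hr, sub_add_cancel, Real.rpow_one]
  have hdpow : d ^ (2 - α) = d * d ^ (1 - α) := by
    rw [← Real.rpow_one_add' hd0.le (by linarith)]
    ring_nf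
  have hmono : ‖y - x‖ ^ (1 - α) ≤ d ^ (1 - α) :=
    Real.rpow_le_rpow hr.le hd (by linarith)
  have hra : 0 < ‖y - x‖ ^ α := Real.rpow_pos_of_pos hr α
  rw [abs_div, abs_of_pos hra, div_le_iff₀ hra, sq_sub_sq, abs_mul, hdpow,
    abs_of_nonneg (by positivity)]
  calc (‖y - x₀‖ + ‖x - x₀‖) * |‖y - x₀‖ - ‖x - x₀‖|
      ≤ (d + d) * ‖y - x‖ := by gcongr
    _ = (d + d) * (‖y - x‖ ^ (1 - α) * ‖y - x‖ ^ α) := by rw [← hpow]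
    _ ≤ (d + d) * (d ^ (1 - α) * ‖y - x‖ ^ α) := by gcongr
    _ = 2 * (d * d ^ (1 - α)) * ‖y - x‖ ^ α := by ring

/-- Quadratic perturbation estimate: for `φ_δ(x) = φ(x) + δ‖x − x₀‖²`,
`|L⁺[φ_δ] − L⁺[φ]| ≤ 2|δ| diam(Ω)^(2−α)`, similarly for `L⁻`, and hence
`|L[φ_δ] − L[φ]| ≤ 4|δ| diam(Ω)^(2−α)` on `Ω̄`. -/
theorem stmt_8 (n : ℕ) (hn : 1 ≤ n) (Ω : Set (EuclideanSpace ℝ (Fin n)))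
    (hΩo : IsOpen Ω) (hΩne : Ω.Nonempty) (hΩb : Bornology.IsBounded Ω)
    (α : ℝ) (hα0 : 0 < α) (hα1 : α ≤ 1)
    (φ : EuclideanSpace ℝ (Fin n) → ℝ)
    (hφ1 : ContDiffOn ℝ 1 φ Ω) (hφc : ContinuousOn φ (closure Ω))
    (x₀ : EuclideanSpace ℝ (Fin n)) (hx₀ : x₀ ∈ closure Ω) (δ : ℝ) :
    ∀ x ∈ closure Ω,
      |Lplus Ω α (fun z => φ z + δ * ‖z - x₀‖ ^ 2) x - Lplus Ω α φ x| ≤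
        2 * |δ| * Metric.diam Ω ^ (2 - α) ∧
      |Lminus Ω α (fun z => φ z + δ * ‖z - x₀‖ ^ 2) x - Lminus Ω α φ x| ≤
        2 * |δ| * Metric.diam Ω ^ (2 - α) ∧
      |Lop Ω α (fun z => φ z + δ * ‖z - x₀‖ ^ 2) x - Lop Ω α φ x| ≤
        4 * |δ| * Metric.diam Ω ^ (2 - α) := by
  intro x hx
  have hdist : ∀ y ∈ closure Ω, ∀ z ∈ closure Ω, ‖y - z‖ ≤ Metric.diam Ω := fun y hy z hz => by
    rw [← dist_eq_norm, ← Metric.diam_closure]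
    exact Metric.dist_le_diam_of_mem hΩb.closure hy hz
  have hC : 0 ≤ 2 * |δ| * Metric.diam Ω ^ (2 - α) := by
    have := Real.rpow_nonneg (Metric.diam_nonneg (s := Ω)) (2 - α)
    positivity
  have hquot : ∀ y ∈ closure Ω \ {x},
      |(φ y + δ * ‖y - x₀‖ ^ 2 - (φ x + δ * ‖x - x₀‖ ^ 2)) / ‖y - x‖ ^ α -
        (φ y - φ x) / ‖y - x‖ ^ α| ≤ 2 * |δ| * Metric.diam Ω ^ (2 - α) := by
    rintro y ⟨hy, hyx⟩
    have h := abs_sq_norm_sub_div_rpow_le hα1 hyx (hdist y hy x hx) (hdist y hy x₀ hx₀)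
      (hdist x hx x₀ hx₀)
    calc _ = |δ * ((‖y - x₀‖ ^ 2 - ‖x - x₀‖ ^ 2) / ‖y - x‖ ^ α)| := by congr 1; ring
      _ ≤ |δ| * (2 * Metric.diam Ω ^ (2 - α)) := by rw [abs_mul]; gcongr
      _ = _ := by ring
  have hplus : |Lplus Ω α (fun z => φ z + δ * ‖z - x₀‖ ^ 2) x - Lplus Ω α φ x| ≤
      2 * |δ| * Metric.diam Ω ^ (2 - α) := abs_sSup_image_sub_sSup_image_le hC hquot
  have hminus : |Lminus Ω α (fun z => φ z + δ * ‖z - x₀‖ ^ 2) x - Lminus Ω α φ x| ≤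
      2 * |δ| * Metric.diam Ω ^ (2 - α) := abs_sInf_image_sub_sInf_image_le hC hquot
  refine ⟨hplus, hminus, ?_⟩
  rw [Lop, Lop, add_sub_add_comm]
  linarith [abs_add_le
    (Lplus Ω α (fun z => φ z + δ * ‖z - x₀‖ ^ 2) x - Lplus Ω α φ x)
    (Lminus Ω α (fun z => φ z + δ * ‖z - x₀‖ ^ 2) x - Lminus Ω α φ x)]
end

section
/- Let α ∈ (0,1] and assume f : ℝ → ℝ is non-decreasing. Let u be a viscosity subsolution of L[u] = f(u) on Ω, and let v : Ω̄ → ℝ be continuously differentiable on Ω, continuous on Ω̄, and a strict viscosity supersolution of L[v] = f(v) on Ω. If u ≤ v on ∂Ω, then u(x) < v(x) for every x ∈ Ω. -/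
open Set Metric

/-- `u` is a viscosity subsolution of `L[u] = f(u)` on `U ⊆ Ω`. -/
def IsViscositySubsolution {n : ℕ} (Ω U : Set (EuclideanSpace ℝ (Fin n))) (α : ℝ)
    (f : ℝ → ℝ) (u : EuclideanSpace ℝ (Fin n) → ℝ) : Prop :=
  UpperSemicontinuousOn u (closure Ω) ∧
  ∀ φ : EuclideanSpace ℝ (Fin n) → ℝ,
    ContDiffOn ℝ 1 φ U → ContinuousOn φ (closure Ω) →
    (∀ x ∈ closure Ω, u x ≤ φ x) →
    ∀ x₀ ∈ U, u x₀ = φ x₀ → -Lop Ω α φ x₀ + f (φ x₀) ≤ 0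

/-- `u` is a viscosity supersolution of `L[u] = f(u)` on `U ⊆ Ω`. -/
def IsViscositySupersolution {n : ℕ} (Ω U : Set (EuclideanSpace ℝ (Fin n))) (α : ℝ)
    (f : ℝ → ℝ) (u : EuclideanSpace ℝ (Fin n) → ℝ) : Prop :=
  LowerSemicontinuousOn u (closure Ω) ∧
  ∀ φ : EuclideanSpace ℝ (Fin n) → ℝ,
    ContDiffOn ℝ 1 φ U → ContinuousOn φ (closure Ω) →
    (∀ x ∈ closure Ω, φ x ≤ u x) →
    ∀ x₀ ∈ U, u x₀ = φ x₀ → 0 ≤ -Lop Ω α φ x₀ + f (φ x₀)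

/-- `u` is a strict viscosity supersolution of `L[u] = f(u)` on `U ⊆ Ω`. -/
def IsStrictViscositySupersolution {n : ℕ} (Ω U : Set (EuclideanSpace ℝ (Fin n))) (α : ℝ)
    (f : ℝ → ℝ) (u : EuclideanSpace ℝ (Fin n) → ℝ) : Prop :=
  LowerSemicontinuousOn u (closure Ω) ∧
  ∀ φ : EuclideanSpace ℝ (Fin n) → ℝ,
    ContDiffOn ℝ 1 φ U → ContinuousOn φ (closure Ω) →
    (∀ x ∈ closure Ω, φ x ≤ u x) →
    ∀ x₀ ∈ U, u x₀ = φ x₀ → 0 < -Lop Ω α φ x₀ + f (φ x₀)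

/-- `L[u]` is unchanged when a constant is added to `u`. -/
theorem Lop_add_const {n : ℕ} (Ω : Set (EuclideanSpace ℝ (Fin n))) (α : ℝ)
    (u : EuclideanSpace ℝ (Fin n) → ℝ) (c : ℝ) (x : EuclideanSpace ℝ (Fin n)) :
    Lop Ω α (fun y => u y + c) x = Lop Ω α u x := by
  simp only [Lop, Lplus, Lminus, add_sub_add_right_eq_sub]

/-- Comparison principle: if `f` is non-decreasing, `u` is a viscosity
subsolution of `L[u] = f(u)` on `Ω`, and `v ∈ C¹(Ω) ∩ C(Ω̄)` is a strict
viscosity supersolution with `u ≤ v` on `∂Ω`, then `u < v` in `Ω`. -/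
theorem stmt_10 (n : ℕ) (hn : 1 ≤ n) (Ω : Set (EuclideanSpace ℝ (Fin n)))
    (hΩo : IsOpen Ω) (hΩne : Ω.Nonempty) (hΩb : Bornology.IsBounded Ω)
    (α : ℝ) (hα0 : 0 < α) (hα1 : α ≤ 1)
    (f : ℝ → ℝ) (hf : Monotone f)
    (u v : EuclideanSpace ℝ (Fin n) → ℝ)
    (hu : IsViscositySubsolution Ω Ω α f u)
    (hv1 : ContDiffOn ℝ 1 v Ω) (hvc : ContinuousOn v (closure Ω))
    (hv : IsStrictViscositySupersolution Ω Ω α f v)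
    (hbd : ∀ x ∈ frontier Ω, u x ≤ v x) :
    ∀ x ∈ Ω, u x < v x := by
  intro x₁ hx₁
  by_contra! hle
  have husc : UpperSemicontinuousOn (fun x => u x + -v x) (closure Ω) :=
    hu.1.add hvc.neg.upperSemicontinuousOn
  obtain ⟨x₀, hx₀, hmax, hnonneg⟩ :
      ∃ x₀ ∈ Ω, (∀ x ∈ closure Ω, u x + -v x ≤ u x₀ + -v x₀) ∧ v x₀ ≤ u x₀ := by
    obtain ⟨z, hz, hzmax⟩ := husc.exists_isMaxOn ⟨x₁, subset_closure hx₁⟩ hΩb.isCompact_closure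
    have hzmax : ∀ x ∈ closure Ω, u x + -v x ≤ u z + -v z := fun x hx => hzmax hx
    have hz₁ := hzmax x₁ (subset_closure hx₁)
    by_cases hzΩ : z ∈ Ω
    · exact ⟨z, hzΩ, hzmax, by linarith⟩
    · have hzb : u z ≤ v z := hbd z (by rw [hΩo.frontier_eq]; exact ⟨hz, hzΩ⟩)
      exact ⟨x₁, hx₁, fun x hx => by linarith [hzmax x hx], hle⟩
  have hsub := hu.2 (fun x => v x + (u x₀ - v x₀)) (hv1.add contDiffOn_const)
    (hvc.add continuousOn_const) (fun x hx => by linarith [hmax x hx]) x₀ hx₀ (by ring)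
  have hsup := hv.2 v hv1 hvc (fun _ _ => le_rfl) x₀ hx₀ rfl
  rw [Lop_add_const] at hsub
  have hfle : f (v x₀) ≤ f (v x₀ + (u x₀ - v x₀)) := hf (by linarith)
  linarith
end

section
/- Let α ∈ (0,1] and assume f : ℝ → ℝ is continuous. Let G be a nonempty family of viscosity supersolutions of L[u] = f(u) on Ω. Define w(x) = inf{u(x) : u ∈ G} for x ∈ Ω̄ and assume w is finite everywhere, lower semicontinuous on Ω̄, and continuous on Ω. Then w is a viscosity supersolution of L[u] = f(u) on Ω. -/
open Set Metric

open Filter Topology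

section Aux

variable {n : ℕ} {Ω : Set (EuclideanSpace ℝ (Fin n))} {α : ℝ}
  {φ ψ : EuclideanSpace ℝ (Fin n) → ℝ} {x : EuclideanSpace ℝ (Fin n)}

lemma norm_sub_rpow_pos {E : Type*} [NormedAddCommGroup E] {x y : E} (h : y ≠ x) :
    0 < ‖y - x‖ ^ α :=
  Real.rpow_pos_of_pos (norm_pos_iff.2 (sub_ne_zero.2 h)) α

lemma closure_diff_singleton_nonempty (hn : 1 ≤ n) (hΩo : IsOpen Ω) (hx : x ∈ Ω) :
    (closure Ω \ {x}).Nonempty := by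
  have : Nonempty (Fin n) := ⟨⟨0, hn⟩⟩
  have h : ∀ᶠ y in 𝓝[≠] x, y ∈ closure Ω \ {x} := by
    filter_upwards [self_mem_nhdsWithin, nhdsWithin_le_nhds (hΩo.mem_nhds hx)] with y hy hy'
    exact ⟨subset_closure hy', hy⟩
  exact h.exists

/-- A continuous function that is differentiable at `x` satisfies a Hölder bound centred at `x`. -/
lemma exists_holder_bound (hΩb : Bornology.IsBounded Ω) (hα0 : 0 < α) (hα1 : α ≤ 1)
    (hd : DifferentiableAt ℝ φ x) (hc : ContinuousOn φ (closure Ω)) (hx : x ∈ closure Ω) :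
    ∃ C, ∀ y ∈ closure Ω, |φ y - φ x| ≤ C * ‖y - x‖ ^ α := by
  obtain ⟨K, hK0, hK⟩ := hd.hasFDerivAt.isBigO_sub.exists_nonneg
  obtain ⟨r, hr, hrK⟩ := Metric.eventually_nhds_iff.1 hK.bound
  obtain ⟨M, hM⟩ := hΩb.isCompact_closure.exists_bound_of_continuousOn hc
  have hM0 : 0 ≤ M := (norm_nonneg _).trans (hM x hx)
  set s := min r 1
  have hs : 0 < s := lt_min hr one_pos
  refine ⟨K + 2 * M / s ^ α, fun y hy => ?_⟩
  have hsα : 0 < s ^ α := Real.rpow_pos_of_pos hs α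
  have hq : 0 ≤ 2 * M / s ^ α := by positivity
  have hp : 0 ≤ ‖y - x‖ ^ α := by positivity
  rw [add_mul]
  rcases lt_or_ge ‖y - x‖ s with h | h
  · have h1 : ‖φ y - φ x‖ ≤ K * ‖y - x‖ :=
      hrK (by rw [dist_eq_norm]; exact h.trans_le (min_le_left _ _))
    have h2 : ‖y - x‖ ≤ ‖y - x‖ ^ α :=
      Real.self_le_rpow_of_le_one (norm_nonneg _) (h.le.trans (min_le_right _ _)) hα1
    have h3 := mul_le_mul_of_nonneg_left h2 hK0
    rw [Real.norm_eq_abs] at h1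
    linarith [mul_nonneg hq hp]
  · have h1 : s ^ α ≤ ‖y - x‖ ^ α := Real.rpow_le_rpow hs.le h hα0.le
    have h2 : 2 * M ≤ 2 * M / s ^ α * ‖y - x‖ ^ α := by
      calc 2 * M = 2 * M / s ^ α * s ^ α := by field_simp
        _ ≤ _ := mul_le_mul_of_nonneg_left h1 hq
    have h3 := abs_sub (φ y) (φ x)
    have h4 := hM y hy
    have h5 := hM x hx
    rw [Real.norm_eq_abs] at h4 h5
    linarith [mul_nonneg hK0 hp]

lemma bddAbove_quotients {C : ℝ} (h : ∀ y ∈ closure Ω, |φ y - φ x| ≤ C * ‖y - x‖ ^ α) :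
    BddAbove ((fun y => (φ y - φ x) / ‖y - x‖ ^ α) '' (closure Ω \ {x})) := by
  refine ⟨C, ?_⟩
  rintro _ ⟨y, hy, rfl⟩
  exact (div_le_iff₀ (norm_sub_rpow_pos hy.2)).2 ((le_abs_self _).trans (h y hy.1))

lemma bddBelow_quotients {C : ℝ} (h : ∀ y ∈ closure Ω, |φ y - φ x| ≤ C * ‖y - x‖ ^ α) :
    BddBelow ((fun y => (φ y - φ x) / ‖y - x‖ ^ α) '' (closure Ω \ {x})) := by
  refine ⟨-C, ?_⟩
  rintro _ ⟨y, hy, rfl⟩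
  refine (le_div_iff₀ (norm_sub_rpow_pos hy.2)).2 ?_
  linarith [h y hy.1, neg_abs_le (φ y - φ x)]

lemma le_Lplus {C : ℝ} (h : ∀ y ∈ closure Ω, |φ y - φ x| ≤ C * ‖y - x‖ ^ α)
    {y : EuclideanSpace ℝ (Fin n)} (hy : y ∈ closure Ω) (hyx : y ≠ x) :
    (φ y - φ x) / ‖y - x‖ ^ α ≤ Lplus Ω α φ x :=
  le_csSup (bddAbove_quotients h) ⟨y, ⟨hy, hyx⟩, rfl⟩

lemma Lminus_mul_le (hα0 : 0 < α) {C : ℝ}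
    (h : ∀ y ∈ closure Ω, |φ y - φ x| ≤ C * ‖y - x‖ ^ α)
    {y : EuclideanSpace ℝ (Fin n)} (hy : y ∈ closure Ω) :
    Lminus Ω α φ x * ‖y - x‖ ^ α ≤ φ y - φ x := by
  rcases eq_or_ne y x with rfl | hyx
  · simp [Real.zero_rpow hα0.ne']
  · exact (le_div_iff₀ (norm_sub_rpow_pos hyx)).1
      (csInf_le (bddBelow_quotients h) ⟨y, ⟨hy, hyx⟩, rfl⟩)

lemma le_Lminus (hne : (closure Ω \ {x}).Nonempty) {c : ℝ}
    (h : ∀ y ∈ closure Ω, c * ‖y - x‖ ^ α ≤ φ y - φ x) : c ≤ Lminus Ω α φ x := by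
  refine le_csInf (hne.image _) ?_
  rintro _ ⟨y, hy, rfl⟩
  exact (le_div_iff₀ (norm_sub_rpow_pos hy.2)).2 (h y hy.1)

/-- Perturbing the increments by at most `κ ‖y - x‖ ^ α` lowers `Lop` by at most `2 κ`. -/
lemma Lop_sub_le (hα0 : 0 < α) (hne : (closure Ω \ {x}).Nonempty) {C C' κ : ℝ}
    (h : ∀ y ∈ closure Ω, |φ y - φ x| ≤ C * ‖y - x‖ ^ α)
    (h' : ∀ y ∈ closure Ω, |ψ y - ψ x| ≤ C' * ‖y - x‖ ^ α)
    (hκ : ∀ y ∈ closure Ω, φ y - φ x - κ * ‖y - x‖ ^ α ≤ ψ y - ψ x) :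
    Lop Ω α φ x - 2 * κ ≤ Lop Ω α ψ x := by
  have h1 : Lplus Ω α φ x ≤ Lplus Ω α ψ x + κ := by
    refine csSup_le (hne.image _) ?_
    rintro _ ⟨y, hy, rfl⟩
    have hp : 0 < ‖y - x‖ ^ α := norm_sub_rpow_pos hy.2
    have h2 := (div_le_iff₀ hp).1 (le_Lplus h' hy.1 hy.2)
    refine (div_le_iff₀ hp).2 ?_
    linarith [hκ y hy.1]
  have h2 : Lminus Ω α φ x - κ ≤ Lminus Ω α ψ x := by
    refine le_Lminus hne fun y hy => ?_
    linarith [hκ y hy, Lminus_mul_le hα0 h hy]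
  unfold Lop
  linarith

/-- `Lplus` is lower semicontinuous at interior points. -/
lemma eventually_lt_Lplus (hn : 1 ≤ n) (hΩo : IsOpen Ω)
    (hφ : ContinuousAt φ x)
    (hb : ∀ z ∈ Ω, ∃ C, ∀ y ∈ closure Ω, |φ y - φ z| ≤ C * ‖y - z‖ ^ α)
    (hx : x ∈ Ω) {η : ℝ} (hη : 0 < η) :
    ∀ᶠ z in 𝓝 x, Lplus Ω α φ x - η < Lplus Ω α φ z := by
  obtain ⟨_, ⟨y, hy, rfl⟩, hlt⟩ := exists_lt_of_lt_csSup
    ((closure_diff_singleton_nonempty hn hΩo hx).image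
      (fun y => (φ y - φ x) / ‖y - x‖ ^ α)) (sub_lt_self (Lplus Ω α φ x) hη)
  have hyx : ‖y - x‖ ≠ 0 := norm_ne_zero_iff.2 (sub_ne_zero.2 hy.2)
  have hct : ContinuousAt (fun z => (φ y - φ z) / ‖y - z‖ ^ α) x := by
    refine (continuousAt_const.sub hφ).div ?_ (norm_sub_rpow_pos hy.2).ne'
    exact (by fun_prop : ContinuousAt (fun z => ‖y - z‖) x).rpow_const (Or.inl hyx)
  filter_upwards [hct.eventually_const_lt hlt, hΩo.mem_nhds hx,
    isOpen_ne.mem_nhds (Ne.symm hy.2)] with z hz hzΩ hzy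
  obtain ⟨C, hC⟩ := hb z hzΩ
  exact hz.trans_le (le_Lplus hC hy.1 (Ne.symm hzy))

/-- `Lminus` is lower semicontinuous at interior points of strict differentiability. -/
lemma eventually_le_Lminus (hn : 1 ≤ n) (hΩo : IsOpen Ω) (hΩb : Bornology.IsBounded Ω)
    (hα0 : 0 < α) (hα1 : α ≤ 1) {φ' : EuclideanSpace ℝ (Fin n) →L[ℝ] ℝ}
    (hφ : HasStrictFDerivAt φ φ' x) (hc : ContinuousOn φ (closure Ω))
    (hb : ∀ z ∈ Ω, ∃ C, ∀ y ∈ closure Ω, |φ y - φ z| ≤ C * ‖y - z‖ ^ α)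
    (hx : x ∈ Ω) {η : ℝ} (hη : 0 < η) :
    ∀ᶠ z in 𝓝 x, Lminus Ω α φ x - η ≤ Lminus Ω α φ z := by
  obtain ⟨C, hC⟩ := hb x hx
  set m := Lminus Ω α φ x
  have key : ∀ᶠ z in 𝓝 x, ∀ y ∈ closure Ω, y ∈ closure Ω →
      (m - η) * ‖y - z‖ ^ α ≤ φ y - φ z := by
    refine hΩb.isCompact_closure.eventually_forall_of_forall_eventually fun y hy => ?_
    rcases eq_or_ne y x with rfl | hyx
    · have hs := hφ.isLittleO.bound (half_pos hη)
      have hs' : ∀ᶠ p : EuclideanSpace ℝ (Fin n) × EuclideanSpace ℝ (Fin n) in 𝓝 (y, y),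
          ‖φ (y + (p.2 - p.1)) - φ y - φ' (y + (p.2 - p.1) - y)‖ ≤
            η / 2 * ‖y + (p.2 - p.1) - y‖ := by
        have ht : Tendsto (fun p : EuclideanSpace ℝ (Fin n) × EuclideanSpace ℝ (Fin n) =>
            (y + (p.2 - p.1), y)) (𝓝 (y, y)) (𝓝 (y, y)) := by
          have : ContinuousAt (fun p : EuclideanSpace ℝ (Fin n) × EuclideanSpace ℝ (Fin n) =>
            (y + (p.2 - p.1), y)) (y, y) := by fun_prop
          simpa [ContinuousAt] using this
        exact ht.eventually hs
      have hsw : ∀ᶠ p : EuclideanSpace ℝ (Fin n) × EuclideanSpace ℝ (Fin n) in 𝓝 (y, y),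
          ‖φ p.2 - φ p.1 - φ' (p.2 - p.1)‖ ≤ η / 2 * ‖p.2 - p.1‖ :=
        (continuous_swap.tendsto (y, y)).eventually hs
      have hΩ : ∀ᶠ p : EuclideanSpace ℝ (Fin n) × EuclideanSpace ℝ (Fin n) in 𝓝 (y, y),
          y + (p.2 - p.1) ∈ Ω := by
        have : ContinuousAt (fun p : EuclideanSpace ℝ (Fin n) × EuclideanSpace ℝ (Fin n) =>
          y + (p.2 - p.1)) (y, y) := by fun_prop
        exact this.eventually_mem (hΩo.mem_nhds (by simpa using hx))
      have h1 : ∀ᶠ p : EuclideanSpace ℝ (Fin n) × EuclideanSpace ℝ (Fin n) in 𝓝 (y, y),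
          ‖p.2 - p.1‖ < 1 := by
        have : ContinuousAt (fun p : EuclideanSpace ℝ (Fin n) × EuclideanSpace ℝ (Fin n) =>
          ‖p.2 - p.1‖) (y, y) := by fun_prop
        exact this.eventually_lt_const (by simp)
      filter_upwards [hs', hsw, hΩ, h1] with p hp1 hp2 hp3 hp4 _
      have hm' := Lminus_mul_le hα0 hC (subset_closure hp3)
      rw [add_sub_cancel_left] at hp1 hm'
      rw [Real.norm_eq_abs, abs_le] at hp1 hp2
      have hpow := mul_le_mul_of_nonneg_left
        (Real.self_le_rpow_of_le_one (norm_nonneg _) hp4.le hα1) hη.le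
      linarith [hp1.2, hp2.1]
    · have hnorm : ‖y - x‖ ≠ 0 := norm_ne_zero_iff.2 (sub_ne_zero.2 hyx)
      have hlt : (m - η) * ‖y - x‖ ^ α < φ y - φ x := by
        have := Lminus_mul_le hα0 hC hy
        have := mul_pos hη (norm_sub_rpow_pos (α := α) hyx)
        linarith
      have hL : Tendsto (fun p : EuclideanSpace ℝ (Fin n) × EuclideanSpace ℝ (Fin n) =>
          (m - η) * ‖p.2 - p.1‖ ^ α) (𝓝 x ×ˢ 𝓝[closure Ω] y)
          (𝓝 ((m - η) * ‖y - x‖ ^ α)) :=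
        (((tendsto_snd.mono_right nhdsWithin_le_nhds).sub tendsto_fst).norm.rpow_const
          (Or.inl hnorm)).const_mul _
      have hR : Tendsto (fun p : EuclideanSpace ℝ (Fin n) × EuclideanSpace ℝ (Fin n) =>
          φ p.2 - φ p.1) (𝓝 x ×ˢ 𝓝[closure Ω] y) (𝓝 (φ y - φ x)) :=
        ((hc y hy).tendsto.comp tendsto_snd).sub (hφ.continuousAt.tendsto.comp tendsto_fst)
      have hev := hL.eventually_lt hR hlt
      have hfil : 𝓝 x ×ˢ 𝓝[closure Ω] y = 𝓝[univ ×ˢ closure Ω] (x, y) := by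
        rw [nhdsWithin_prod_eq, nhdsWithin_univ]
      rw [hfil, eventually_nhdsWithin_iff] at hev
      filter_upwards [hev] with p hp hpΩ
      exact (hp ⟨mem_univ _, hpΩ⟩).le
  filter_upwards [key, hΩo.mem_nhds hx] with z hz hzΩ
  exact le_Lminus (closure_diff_singleton_nonempty hn hΩo hzΩ) fun y hy => hz y hy hy

/-- On a bounded set the squared distance to a fixed point is `α`-Hölder for every `α ≤ 1`. -/
lemma exists_holder_sq_norm (hΩb : Bornology.IsBounded Ω) (hα0 : 0 < α) (hα1 : α ≤ 1)
    (hx : x ∈ closure Ω) :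
    ∃ C, 0 ≤ C ∧ ∀ z ∈ closure Ω, ∀ y ∈ closure Ω,
      |‖y - x‖ ^ 2 - ‖z - x‖ ^ 2| ≤ C * ‖y - z‖ ^ α := by
  obtain ⟨D, hD⟩ := Metric.isBounded_iff.1 hΩb.closure
  set R := max D 1
  have hR : 1 ≤ R := le_max_right _ _
  have hR0 : 0 < R := one_pos.trans_le hR
  have hdist : ∀ y ∈ closure Ω, ∀ z ∈ closure Ω, ‖y - z‖ ≤ R := fun y hy z hz => by
    rw [← dist_eq_norm]
    exact (hD hy hz).trans (le_max_left _ _)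
  refine ⟨2 * R * R, by positivity, fun z hz y hy => ?_⟩
  have h1 : |‖y - x‖ - ‖z - x‖| ≤ ‖y - z‖ := by
    simpa using abs_norm_sub_norm_le (y - x) (z - x)
  have h2 : ‖y - z‖ ≤ R * ‖y - z‖ ^ α := by
    have h3 : ‖y - z‖ / R ≤ (‖y - z‖ / R) ^ α :=
      Real.self_le_rpow_of_le_one (by positivity) ((div_le_one hR0).2 (hdist y hy z hz)) hα1
    have h4 : (‖y - z‖ / R) ^ α ≤ ‖y - z‖ ^ α :=
      Real.rpow_le_rpow (by positivity) (div_le_self (norm_nonneg _) hR) hα0.le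
    rw [mul_comm]
    exact (div_le_iff₀ hR0).1 (h3.trans h4)
  have h5 : ‖y - x‖ + ‖z - x‖ ≤ 2 * R := by
    linarith [hdist y hy x hx, hdist z hz x hx]
  calc |‖y - x‖ ^ 2 - ‖z - x‖ ^ 2|
      = (‖y - x‖ + ‖z - x‖) * |‖y - x‖ - ‖z - x‖| := by
        rw [sq_sub_sq, abs_mul, abs_of_nonneg (by positivity)]
    _ ≤ 2 * R * (R * ‖y - z‖ ^ α) :=
        mul_le_mul h5 (h1.trans h2) (abs_nonneg _) (by positivity)
    _ = 2 * R * R * ‖y - z‖ ^ α := by ring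

end Aux

/-- Stability of supersolutions: if `f` is continuous, `G` is a nonempty family
of viscosity supersolutions of `L[u] = f(u)` on `Ω`, and `w(x) = inf {u(x) : u ∈ G}`
is finite everywhere (`IsGLB`), lower semicontinuous on `Ω̄` and continuous on
`Ω`, then `w` is a viscosity supersolution on `Ω`. -/
theorem stmt_12 (n : ℕ) (hn : 1 ≤ n) (Ω : Set (EuclideanSpace ℝ (Fin n)))
    (hΩo : IsOpen Ω) (hΩne : Ω.Nonempty) (hΩb : Bornology.IsBounded Ω)
    (α : ℝ) (hα0 : 0 < α) (hα1 : α ≤ 1)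
    (f : ℝ → ℝ) (hf : Continuous f)
    (G : Set (EuclideanSpace ℝ (Fin n) → ℝ)) (hGne : G.Nonempty)
    (hG : ∀ u ∈ G, IsViscositySupersolution Ω Ω α f u)
    (w : EuclideanSpace ℝ (Fin n) → ℝ)
    (hw : ∀ x ∈ closure Ω, IsGLB ((fun u : EuclideanSpace ℝ (Fin n) → ℝ => u x) '' G) (w x))
    (hwlsc : LowerSemicontinuousOn w (closure Ω))
    (hwc : ContinuousOn w Ω) :
    IsViscositySupersolution Ω Ω α f w := by
  refine ⟨hwlsc, fun φ hφ hφc hle x hx hwx => ?_⟩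
  have hxc := subset_closure hx
  have hbound : ∀ ψ : EuclideanSpace ℝ (Fin n) → ℝ, ContDiffOn ℝ 1 ψ Ω →
      ContinuousOn ψ (closure Ω) → ∀ z ∈ Ω, ∃ C, ∀ y ∈ closure Ω,
        |ψ y - ψ z| ≤ C * ‖y - z‖ ^ α := fun ψ hψ hψc z hz =>
    exists_holder_bound hΩb hα0 hα1
      ((hψ.contDiffAt (hΩo.mem_nhds hz)).differentiableAt one_ne_zero) hψc (subset_closure hz)
  have hφb := hbound φ hφ hφc
  have hstrict := (hφ.contDiffAt (hΩo.mem_nhds hx)).hasStrictFDerivAt one_ne_zero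
  obtain ⟨C, hC0, hC⟩ := exists_holder_sq_norm hΩb hα0 hα1 hxc
  suffices h : ∀ η > 0, Lop Ω α φ x ≤ f (φ x) + η by
    linarith [le_of_forall_pos_le_add h]
  intro η hη
  obtain ⟨ε, hε, hεC⟩ : ∃ ε > 0, 2 * (ε * C) ≤ η / 4 := by
    refine ⟨η / (8 * (C + 1)), by positivity, ?_⟩
    have : η / (8 * (C + 1)) * (C + 1) = η / 8 := by field_simp
    have h0 : 0 < η / (8 * (C + 1)) := by positivity
    linarith
  have hη4 : 0 < η / 4 := by positivity
  have hfc : ContinuousAt (fun p : EuclideanSpace ℝ (Fin n) × ℝ =>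
      f (φ p.1 - ε * ‖p.1 - x‖ ^ 2 + p.2)) (x, 0) := by
    have : ContinuousAt (fun p : EuclideanSpace ℝ (Fin n) × ℝ => φ p.1) (x, 0) :=
      ContinuousAt.comp (f := Prod.fst) (g := φ) hstrict.continuousAt continuousAt_fst
    exact hf.continuousAt.comp ((this.sub (by fun_prop :
      ContinuousAt (fun p : EuclideanSpace ℝ (Fin n) × ℝ => ε * ‖p.1 - x‖ ^ 2) (x, 0))).add
        continuousAt_snd)
  have hfev := hfc.eventually_lt_const (u := f (φ x) + η / 4) (by simpa using hη4)
  have hLev := (hΩo.eventually_mem hx).and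
    ((eventually_lt_Lplus hn hΩo hstrict.continuousAt hφb hx hη4).and
      (eventually_le_Lminus hn hΩo hΩb hα0 hα1 hstrict hφc hφb hx hη4))
  obtain ⟨r, hr, hball⟩ := Metric.eventually_nhds_iff.1
    (hfev.and (hLev.prod_inl_nhds 0))
  obtain ⟨_, ⟨u, hu, rfl⟩, -, hux⟩ := (hw x hxc).exists_between
    (lt_add_of_pos_right (w x) (lt_min hr (by positivity : 0 < ε * r ^ 2)))
  have hφu : ∀ y ∈ closure Ω, φ y ≤ u y := fun y hy =>
    (hle y hy).trans ((hw y hy).1 ⟨u, hu, rfl⟩)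
  have hpc : ContinuousOn (fun y => -(φ y - ε * ‖y - x‖ ^ 2)) (closure Ω) := by fun_prop
  obtain ⟨z, hz, hmin⟩ := LowerSemicontinuousOn.exists_isMinOn ⟨x, hxc⟩
    hΩb.isCompact_closure ((hG u hu).1.add hpc.lowerSemicontinuousOn)
  have hmin' : ∀ y ∈ closure Ω, u z + -(φ z - ε * ‖z - x‖ ^ 2) ≤
      u y + -(φ y - ε * ‖y - x‖ ^ 2) := fun y hy => hmin hy
  set c := u z + -(φ z - ε * ‖z - x‖ ^ 2) with hc
  have hcx : c ≤ u x - φ x := by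
    have := hmin' x hxc
    simp only [sub_self, norm_zero] at this
    linarith
  have hcz : ε * ‖z - x‖ ^ 2 ≤ c := by linarith [hφu z hz]
  have hc0 : 0 ≤ c := le_trans (by positivity) hcz
  have hcr : c < r := by linarith [min_le_left r (ε * r ^ 2)]
  have hzr : ‖z - x‖ < r := by
    have : ε * ‖z - x‖ ^ 2 < ε * r ^ 2 := by linarith [min_le_right r (ε * r ^ 2)]
    exact lt_of_pow_lt_pow_left₀ 2 hr.le (lt_of_mul_lt_mul_left this hε.le)
  obtain ⟨hfz, hzΩ, hpz, hmz⟩ := hball (y := (z, c)) (by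
    rw [Prod.dist_eq, max_lt_iff, dist_eq_norm, Real.dist_eq, sub_zero, abs_of_nonneg hc0]
    exact ⟨hzr, hcr⟩)
  have hψd : ContDiffOn ℝ 1 (fun y => φ y - ε * ‖y - x‖ ^ 2 + c) Ω :=
    (hφ.sub (contDiff_const.mul
      ((contDiff_id.sub contDiff_const).norm_sq ℝ)).contDiffOn).add contDiffOn_const
  have hψc : ContinuousOn (fun y => φ y - ε * ‖y - x‖ ^ 2 + c) (closure Ω) := by fun_prop
  have hsup := (hG u hu).2 _ hψd hψc (fun y hy => by linarith [hmin' y hy]) z hzΩ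
    (by rw [hc]; ring)
  obtain ⟨C₁, hC₁⟩ := hφb z hzΩ
  obtain ⟨C₂, hC₂⟩ := hbound _ hψd hψc z hzΩ
  have hpert := Lop_sub_le (κ := ε * C) hα0 (closure_diff_singleton_nonempty hn hΩo hzΩ) hC₁ hC₂
    (fun y hy => by
      have := mul_le_mul_of_nonneg_left ((le_abs_self _).trans (hC z hz y hy)) hε.le
      linarith)
  have hLφ : Lop Ω α φ x - 2 * (η / 4) ≤ Lop Ω α φ z := by
    unfold Lop
    linarith
  linarith
end

section
/- Let 0 < β < α < 1, assume f : ℝ → ℝ is non-decreasing and continuous, and let g : ∂Ω → ℝ belong to C^{0,β}(∂Ω). Then there exist functions u⁻, u⁺ : Ω̄ → ℝ, both β-Hölder continuous on Ω̄, such that u⁻ is a viscosity subsolution and u⁺ is a viscosity supersolution of L[u] = f(u) on Ω, u⁻ ≤ u⁺ on Ω̄, and u⁻ = u⁺ = g on ∂Ω. -/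
open Set Metric

/-- A function with a Hölder modulus on a set is continuous there. -/
theorem continuousOn_of_abs_sub_le_rpow {E : Type*} [NormedAddCommGroup E] {s : Set E}
    {u : E → ℝ} {K β : ℝ} (hβ : 0 < β)
    (hu : ∀ x ∈ s, ∀ y ∈ s, |u x - u y| ≤ K * ‖x - y‖ ^ β) : ContinuousOn u s := by
  intro x hx
  have hlim : Filter.Tendsto (fun y => K * ‖y - x‖ ^ β) (nhdsWithin x s) (nhds 0) := by
    have hc : Continuous fun y : E => K * ‖y - x‖ ^ β :=
      continuous_const.mul
        ((continuous_id.sub continuous_const).norm.rpow_const fun _ => Or.inr hβ.le)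
    have h := hc.tendsto x
    simp only [sub_self, norm_zero, Real.zero_rpow hβ.ne', mul_zero] at h
    exact h.mono_left nhdsWithin_le_nhds
  refine tendsto_iff_dist_tendsto_zero.2 (squeeze_zero' ?_ ?_ hlim)
  · exact Filter.Eventually.of_forall fun _ => dist_nonneg
  · filter_upwards [self_mem_nhdsWithin] with y hy
    exact hu y hy x hx

theorem norm_sub_rpow_le_add {E : Type*} [NormedAddCommGroup E] {β : ℝ} (hβ0 : 0 ≤ β)
    (hβ1 : β ≤ 1) (x y z : E) : ‖x - z‖ ^ β ≤ ‖x - y‖ ^ β + ‖y - z‖ ^ β :=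
  (Real.rpow_le_rpow (norm_nonneg _) (norm_sub_le_norm_sub_add_norm_sub x y z) hβ0).trans
    (Real.rpow_add_le_add_rpow (norm_nonneg _) (norm_nonneg _) hβ0 hβ1)

/-- The growth of `r ↦ r ^ β` is controlled by the power `α` of the increment, with a constant
`β / α` that is strictly smaller than one for `β < α`. -/
theorem rpow_add_sub_rpow_le {α β ρ r : ℝ} (hβ0 : 0 < β) (hβα : β < α) (hα1 : α < 1)
    (hρ : 0 < ρ) (hr : 0 ≤ r) :
    (ρ + r) ^ β - ρ ^ β ≤ β / α * ρ ^ (β - α) * r ^ α := by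
  have hα0 : 0 < α := hβ0.trans hβα
  have ht : 0 ≤ r / ρ := by positivity
  have hsub : (1 + r / ρ) ^ α ≤ 1 + (r / ρ) ^ α := by
    simpa using Real.rpow_add_le_add_rpow zero_le_one ht hα0.le hα1.le
  have hbern : (1 + r / ρ) ^ β ≤ 1 + β / α * (r / ρ) ^ α := by
    calc (1 + r / ρ) ^ β = ((1 + r / ρ) ^ α) ^ (β / α) := by
          rw [← Real.rpow_mul (by positivity), mul_div_cancel₀ _ hα0.ne']
      _ ≤ (1 + (r / ρ) ^ α) ^ (β / α) :=
          Real.rpow_le_rpow (by positivity) hsub (by positivity)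
      _ ≤ 1 + β / α * (r / ρ) ^ α :=
          rpow_one_add_le_one_add_mul_self
            (by linarith [Real.rpow_nonneg ht α]) (by positivity)
            ((div_le_one hα0).2 hβα.le)
  have hsplit : (ρ + r) ^ β = ρ ^ β * (1 + r / ρ) ^ β := by
    rw [← Real.mul_rpow hρ.le (by positivity)]
    congr 1
    field_simp
  have hscale : ρ ^ β * (r / ρ) ^ α = ρ ^ (β - α) * r ^ α := by
    rw [Real.div_rpow hr hρ.le, Real.rpow_sub hρ]
    ring
  have hmul := mul_le_mul_of_nonneg_left hbern (Real.rpow_nonneg hρ.le β)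
  rw [hsplit]
  linear_combination hmul + β / α * hscale

/-- The difference quotients of an admissible test function are bounded below. -/
theorem bddBelow_holder_quotients {n : ℕ} {Ω : Set (EuclideanSpace ℝ (Fin n))}
    (hΩb : Bornology.IsBounded Ω) {α : ℝ} (hα0 : 0 < α) (hα1 : α < 1)
    {φ : EuclideanSpace ℝ (Fin n) → ℝ} (hφ : ContinuousOn φ (closure Ω))
    {x : EuclideanSpace ℝ (Fin n)} (hd : DifferentiableAt ℝ φ x) :
    BddBelow ((fun y => (φ y - φ x) / ‖y - x‖ ^ α) '' (closure Ω \ {x})) := by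
  obtain ⟨c, hc⟩ := hd.isBigO_sub.bound
  obtain ⟨r, hr0, hr⟩ := Metric.eventually_nhds_iff.1 hc
  obtain ⟨M, hM⟩ := hΩb.isCompact_closure.exists_bound_of_continuousOn hφ
  set ρ : ℝ := min r 1
  have hρ0 : 0 < ρ := lt_min hr0 one_pos
  refine ⟨-max |c| ((|M| + |φ x|) / ρ ^ α), ?_⟩
  rintro _ ⟨y, ⟨hy, hyx⟩, rfl⟩
  have hpos : 0 < ‖y - x‖ := norm_pos_iff.2 (sub_ne_zero.2 hyx)
  have hpow : 0 < ‖y - x‖ ^ α := Real.rpow_pos_of_pos hpos α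
  refine neg_le_of_abs_le ?_
  rw [abs_div, abs_of_pos hpow]
  rcases lt_or_ge ‖y - x‖ ρ with hlt | hge
  · refine le_max_of_le_left ((div_le_iff₀ hpow).2 ?_)
    have hle := hr (y := y) (by rw [dist_eq_norm]; exact hlt.trans_le (min_le_left _ _))
    have hself : ‖y - x‖ ≤ ‖y - x‖ ^ α := by
      simpa using Real.rpow_le_rpow_of_exponent_ge hpos (hlt.le.trans (min_le_right _ _)) hα1.le
    calc |φ y - φ x| ≤ c * ‖y - x‖ := hle
      _ ≤ |c| * ‖y - x‖ := by gcongr; exact le_abs_self c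
      _ ≤ |c| * ‖y - x‖ ^ α := by gcongr
  · refine le_max_of_le_right ?_
    have hnum : |φ y - φ x| ≤ |M| + |φ x| :=
      (norm_sub_le (φ y) (φ x)).trans (by rw [Real.norm_eq_abs (φ x)]; gcongr; exact (hM y hy).trans (le_abs_self M))
    gcongr

theorem Lop_neg {n : ℕ} (Ω : Set (EuclideanSpace ℝ (Fin n))) (α : ℝ)
    (u : EuclideanSpace ℝ (Fin n) → ℝ) (x : EuclideanSpace ℝ (Fin n)) :
    Lop Ω α (fun y => -u y) x = -Lop Ω α u x := by
  have himage : (fun y => (-u y - -u x) / ‖y - x‖ ^ α) '' (closure Ω \ {x}) =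
      -((fun y => (u y - u x) / ‖y - x‖ ^ α) '' (closure Ω \ {x})) := by
    rw [← Set.image_neg_eq_neg, Set.image_image]
    refine Set.image_congr fun y _ => ?_
    ring
  simp only [Lop, Lplus, Lminus]
  rw [himage, Real.sSup_neg, Real.sInf_neg]
  ring

/-- A negated supersolution for the reflected nonlinearity is a subsolution. -/
theorem IsViscositySupersolution.neg {n : ℕ} {Ω U : Set (EuclideanSpace ℝ (Fin n))} {α : ℝ}
    {f : ℝ → ℝ} {u : EuclideanSpace ℝ (Fin n) → ℝ}
    (hu : IsViscositySupersolution Ω U α (fun t => -f (-t)) u) :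
    IsViscositySubsolution Ω U α f fun x => -u x := by
  refine ⟨fun x hx c hc => ?_, fun φ hφd hφc hle x hx heq => ?_⟩
  · filter_upwards [hu.1 x hx (-c) (by linarith)] with y hy
    linarith
  · have h := hu.2 (fun y => -φ y) hφd.neg hφc.neg (fun y hy => by linarith [hle y hy]) x hx
      (by linarith)
    rw [Lop_neg] at h
    simp only [neg_neg] at h
    linarith

/-- A function lying below the cone `x ↦ u x₀ + C (|x - y| ^ β - |x₀ - y| ^ β)` with vertex
`y ≠ x₀` has a quantitatively negative fractional infinity Laplacian at `x₀`. -/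
theorem Lop_le_of_le_cone {n : ℕ} {Ω : Set (EuclideanSpace ℝ (Fin n))}
    (hΩb : Bornology.IsBounded Ω) {α β C : ℝ} (hβ0 : 0 < β) (hβα : β < α) (hα1 : α < 1)
    (hC : 0 ≤ C) {φ : EuclideanSpace ℝ (Fin n) → ℝ} (hφ : ContinuousOn φ (closure Ω))
    {x y : EuclideanSpace ℝ (Fin n)} (hd : DifferentiableAt ℝ φ x) (hy : y ∈ closure Ω)
    (hxy : y ≠ x)
    (hcone : ∀ z ∈ closure Ω, φ z ≤ φ x + C * (‖z - y‖ ^ β - ‖x - y‖ ^ β)) :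
    Lop Ω α φ x ≤ -(C * (1 - β / α) * ‖x - y‖ ^ (β - α)) := by
  have hα0 : 0 < α := hβ0.trans hβα
  have hρ : 0 < ‖x - y‖ := norm_pos_iff.2 (sub_ne_zero.2 hxy.symm)
  have hplus : Lplus Ω α φ x ≤ C * (β / α * ‖x - y‖ ^ (β - α)) := by
    refine Real.sSup_le ?_ (by positivity)
    rintro _ ⟨z, ⟨hz, hzx⟩, rfl⟩
    have hpos : 0 < ‖z - x‖ := norm_pos_iff.2 (sub_ne_zero.2 hzx)
    refine (div_le_iff₀ (Real.rpow_pos_of_pos hpos α)).2 ?_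
    have htri : ‖z - y‖ ^ β ≤ (‖x - y‖ + ‖z - x‖) ^ β :=
      Real.rpow_le_rpow (norm_nonneg _)
        ((norm_sub_le_norm_sub_add_norm_sub z x y).trans_eq (add_comm _ _)) hβ0.le
    have hgrow := rpow_add_sub_rpow_le hβ0 hβα hα1 hρ hpos.le
    have hmul := mul_le_mul_of_nonneg_left
      ((sub_le_sub_right htri (‖x - y‖ ^ β)).trans hgrow) hC
    linarith [hcone z hz]
  have hminus : Lminus Ω α φ x ≤ -(C * ‖x - y‖ ^ (β - α)) := by
    refine (csInf_le (bddBelow_holder_quotients hΩb hα0 hα1 hφ hd)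
      (mem_image_of_mem _ ⟨hy, hxy⟩)).trans ?_
    rw [norm_sub_rev y x]
    refine (div_le_iff₀ (Real.rpow_pos_of_pos hρ α)).2 ?_
    have h := hcone y hy
    rw [sub_self, norm_zero, Real.zero_rpow hβ0.ne'] at h
    rw [neg_mul, mul_assoc, ← Real.rpow_add hρ, sub_add_cancel]
    linarith
  unfold Lop
  linarith

/-- The lower envelope of the cones `x ↦ g y + C |x - y| ^ β` with vertices in a compact set. -/
theorem exists_cone_envelope {E : Type*} [NormedAddCommGroup E] {s : Set E} (hs : IsCompact s)
    (hne : s.Nonempty) {g : E → ℝ} (hg : ContinuousOn g s) {β : ℝ} (hβ0 : 0 < β) (C : ℝ) :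
    ∃ u : E → ℝ, (∀ x, ∃ y ∈ s, u x = g y + C * ‖x - y‖ ^ β) ∧
      ∀ x, ∀ y ∈ s, u x ≤ g y + C * ‖x - y‖ ^ β := by
  have hmin : ∀ x : E, ∃ y ∈ s, IsMinOn (fun y => g y + C * ‖x - y‖ ^ β) s y := fun x =>
    hs.exists_isMinOn hne (hg.add (continuous_const.mul
      ((continuous_const.sub continuous_id).norm.rpow_const
        fun _ => Or.inr hβ0.le)).continuousOn)
  choose v hv hvmin using hmin
  exact ⟨fun x => g (v x) + C * ‖x - v x‖ ^ β, fun x => ⟨v x, hv x, rfl⟩,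
    fun x y hy => hvmin x hy⟩

/-- A cone envelope with large opening is a Hölder supersolution with the given boundary data. -/
theorem exists_holder_supersolution {n : ℕ} {Ω : Set (EuclideanSpace ℝ (Fin n))}
    (hΩo : IsOpen Ω) (hΩb : Bornology.IsBounded Ω) (hne : (frontier Ω).Nonempty)
    {α β : ℝ} (hβ0 : 0 < β) (hβα : β < α) (hα1 : α < 1) {f : ℝ → ℝ} (hfm : Monotone f)
    {g : EuclideanSpace ℝ (Fin n) → ℝ} {K : ℝ} (hK : 0 ≤ K)
    (hg : ∀ x ∈ frontier Ω, ∀ y ∈ frontier Ω, |g x - g y| ≤ K * ‖x - y‖ ^ β) :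
    ∃ (u : EuclideanSpace ℝ (Fin n) → ℝ) (C : ℝ), K ≤ C ∧
      (∀ x y, |u x - u y| ≤ C * ‖x - y‖ ^ β) ∧
      IsViscositySupersolution Ω Ω α f u ∧
      (∀ x ∈ frontier Ω, u x = g x) ∧
      ∀ x, ∃ y ∈ frontier Ω, u x = g y + C * ‖x - y‖ ^ β := by
  have hα0 : 0 < α := hβ0.trans hβα
  have hcomp : IsCompact (frontier Ω) :=
    hΩb.isCompact_closure.of_isClosed_subset isClosed_frontier frontier_subset_closure
  have hgc : ContinuousOn g (frontier Ω) := continuousOn_of_abs_sub_le_rpow hβ0 hg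
  obtain ⟨p, hp, hpmin⟩ := hcomp.exists_isMinOn hne hgc
  obtain ⟨D, hD0, hD⟩ := hΩb.closure.exists_pos_norm_le
  have hδ : 0 < 1 - β / α := sub_pos.2 ((div_lt_one hα0).2 hβα)
  have hden : 0 < (1 - β / α) * (2 * D) ^ (β - α) :=
    mul_pos hδ (Real.rpow_pos_of_pos (by positivity) _)
  set C : ℝ := max K (|f (g p)| / ((1 - β / α) * (2 * D) ^ (β - α)))
  have hKC : K ≤ C := le_max_left _ _
  have hC0 : 0 ≤ C := hK.trans hKC
  have hCf : |f (g p)| ≤ C * ((1 - β / α) * (2 * D) ^ (β - α)) :=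
    (div_le_iff₀ hden).1 (le_max_right _ _)
  obtain ⟨u, hatt, hle⟩ := exists_cone_envelope hcomp hne hgc hβ0 C
  have hub : ∀ x y, u x - u y ≤ C * ‖x - y‖ ^ β := by
    intro x y
    obtain ⟨z, hz, huz⟩ := hatt y
    have htri := mul_le_mul_of_nonneg_left
      (norm_sub_rpow_le_add hβ0.le (hβα.trans hα1).le x y z) hC0
    linarith [hle x z hz]
  have hhol : ∀ x y, |u x - u y| ≤ C * ‖x - y‖ ^ β := fun x y =>
    abs_sub_le_iff.2 ⟨hub x y, by rw [norm_sub_rev]; exact hub y x⟩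
  refine ⟨u, C, hKC, hhol, ⟨?_, ?_⟩, ?_, hatt⟩
  · exact (continuousOn_of_abs_sub_le_rpow hβ0
      fun x _ y _ => hhol x y).lowerSemicontinuousOn
  · intro φ hφd hφc hφu x hx heq
    obtain ⟨y, hy, huy⟩ := hatt x
    have hyc : y ∈ closure Ω := frontier_subset_closure hy
    have hyx : y ≠ x := by
      rintro rfl
      exact disjoint_left.1 (disjoint_frontier_iff_isOpen.2 hΩo).symm hx hy
    have hlop := Lop_le_of_le_cone hΩb hβ0 hβα hα1 hC0 hφc
      ((hφd.differentiableOn one_ne_zero).differentiableAt (hΩo.mem_nhds hx)) hyc hyx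
      fun z hz => by linarith [hφu z hz, hle z y hy]
    have hfx : f (g p) ≤ f (φ x) := by
      refine hfm (?_ : g p ≤ φ x)
      have hgp : g p ≤ g y := hpmin hy
      have hnn : 0 ≤ C * ‖x - y‖ ^ β := by positivity
      linarith
    have hnorm : ‖x - y‖ ≤ 2 * D :=
      (norm_sub_le x y).trans (by linarith [hD x (subset_closure hx), hD y hyc])
    have hpow : (2 * D) ^ (β - α) ≤ ‖x - y‖ ^ (β - α) :=
      Real.rpow_le_rpow_of_nonpos (norm_pos_iff.2 (sub_ne_zero.2 hyx.symm)) hnorm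
        (by linarith)
    have hmul := mul_le_mul_of_nonneg_left hpow (mul_nonneg hC0 hδ.le)
    linarith [neg_abs_le (f (g p))]
  · intro x hx
    refine le_antisymm ?_ ?_
    · simpa [Real.zero_rpow hβ0.ne'] using hle x x hx
    · obtain ⟨y, hy, huy⟩ := hatt x
      have hmul := mul_le_mul_of_nonneg_right hKC (Real.rpow_nonneg (norm_nonneg (x - y)) β)
      linarith [le_abs_self (g x - g y), hg x hx y hy]

/-- A nonempty bounded set in a nontrivial real normed space has nonempty boundary. -/
theorem frontier_nonempty_of_isBounded {E : Type*} [NormedAddCommGroup E] [NormedSpace ℝ E]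
    [Nontrivial E] {s : Set E} (hne : s.Nonempty) (hb : Bornology.IsBounded s) :
    (frontier s).Nonempty := by
  rw [nonempty_frontier_iff]
  refine ⟨hne, ?_⟩
  rintro rfl
  exact NormedSpace.unbounded_univ ℝ E hb

/-- Existence of an ordered pair of a β-Hölder subsolution and supersolution of
`L[u] = f(u)` attaining the β-Hölder boundary datum `g` on `∂Ω`. -/
theorem stmt_13 (n : ℕ) (hn : 1 ≤ n) (Ω : Set (EuclideanSpace ℝ (Fin n)))
    (hΩo : IsOpen Ω) (hΩne : Ω.Nonempty) (hΩb : Bornology.IsBounded Ω)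
    (α β : ℝ) (hβ0 : 0 < β) (hβα : β < α) (hα1 : α < 1)
    (f : ℝ → ℝ) (hfm : Monotone f) (hfc : Continuous f)
    (g : EuclideanSpace ℝ (Fin n) → ℝ)
    (hg : ∃ K : ℝ, ∀ x ∈ frontier Ω, ∀ y ∈ frontier Ω,
      |g x - g y| ≤ K * ‖x - y‖ ^ β) :
    ∃ um up : EuclideanSpace ℝ (Fin n) → ℝ,
      (∃ K : ℝ, ∀ x ∈ closure Ω, ∀ y ∈ closure Ω,
        |um x - um y| ≤ K * ‖x - y‖ ^ β) ∧
      (∃ K : ℝ, ∀ x ∈ closure Ω, ∀ y ∈ closure Ω,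
        |up x - up y| ≤ K * ‖x - y‖ ^ β) ∧
      IsViscositySubsolution Ω Ω α f um ∧
      IsViscositySupersolution Ω Ω α f up ∧
      (∀ x ∈ closure Ω, um x ≤ up x) ∧
      (∀ x ∈ frontier Ω, um x = g x ∧ up x = g x) := by
  have : Nonempty (Fin n) := ⟨⟨0, hn⟩⟩
  have hne := frontier_nonempty_of_isBounded hΩne hΩb
  obtain ⟨K, hK⟩ := hg
  have hgK : ∀ x ∈ frontier Ω, ∀ y ∈ frontier Ω, |g x - g y| ≤ |K| * ‖x - y‖ ^ β :=
    fun x hx y hy => (hK x hx y hy).trans (by gcongr; exact le_abs_self K)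
  obtain ⟨up, C, hKC, hhol, hsup, hbd, hatt⟩ :=
    exists_holder_supersolution hΩo hΩb hne hβ0 hβα hα1 hfm (abs_nonneg K) hgK
  obtain ⟨v, C', hKC', hhol', hsup', hbd', hatt'⟩ :=
    exists_holder_supersolution (f := fun t => -f (-t)) (g := fun x => -g x)
      hΩo hΩb hne hβ0 hβα hα1 (fun s t hst => neg_le_neg (hfm (neg_le_neg hst))) (abs_nonneg K)
      fun x hx y hy => by
        rw [neg_sub_neg, abs_sub_comm]
        exact hgK x hx y hy
  refine ⟨fun x => -v x, up, ⟨C', fun x _ y _ => ?_⟩, ⟨C, fun x _ y _ => hhol x y⟩,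
    hsup'.neg, hsup, fun x _ => ?_, fun x hx => ⟨?_, hbd x hx⟩⟩
  · rw [neg_sub_neg, abs_sub_comm]
    exact hhol' x y
  · obtain ⟨y, hy, huy⟩ := hatt x
    obtain ⟨z, hz, hvz⟩ := hatt' x
    have htri := mul_le_mul_of_nonneg_left
      (norm_sub_rpow_le_add hβ0.le (hβα.trans hα1).le z x y) (abs_nonneg K)
    have hy' := mul_le_mul_of_nonneg_right hKC (Real.rpow_nonneg (norm_nonneg (x - y)) β)
    have hz' := mul_le_mul_of_nonneg_right hKC' (Real.rpow_nonneg (norm_nonneg (x - z)) β)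
    rw [norm_sub_rev z x] at htri
    linarith [le_abs_self (g z - g y), hgK z hz y hy]
  · simp [hbd' x hx]
end
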